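/- Let 𝒜 ⊆ ℂ^N be an irreducible algebraic set of positive dimension (equivalently, infinite) and let f : 𝒜 → ℂ^M be a proper holomorphic mapping on 𝒜. Let b ∈ f(𝒜) and δ > 0 and put K := f(𝒜) ∩ B̄(b,δ) (B̄ the closed Euclidean ball). If there exists d > 0 such that V_K(f(z)) ≤ d · V_{f⁻¹(K)}(z) for all z ∈ 𝒜, then limsup_{𝒜∋z→∞} log‖f(z)‖/log‖z‖ ≤ d, i.e. the growth exponent satisfies ρ(f,𝒜) ≤ d. -/

import Mathlib

open Filter MvPolynomial Metric Set ENNReal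

/-- extended logarithm of a nonnegative real number, with `elog 0 = -∞`. -/
noncomputable def elog (t : ℝ) : EReal := if t = 0 then ⊥ else ((Real.log t : ℝ) : EReal)

/-- the filter of points of `V` whose norm tends to infinity. -/
def atInftyOn {E : Type*} [Norm E] (V : Set E) : Filter E :=
  (Filter.comap (fun z => ‖z‖) Filter.atTop) ⊓ Filter.principal V

/-- the quotient `log ‖f z‖ / log ‖z‖`, computed in the extended reals. -/
noncomputable def logRatio {E F : Type*} [Norm E] [Norm F] (f : E → F) (z : E) : EReal :=
  elog ‖f z‖ / elog ‖z‖

/-- the growth exponent `ρ(f, V)` of `f` on `V`. -/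
noncomputable def growthExp {E F : Type*} [Norm E] [Norm F] (f : E → F) (V : Set E) : EReal :=
  Filter.limsup (logRatio f) (atInftyOn V)

/-- `log ‖f⁻¹(w)‖ = log sup {‖z‖ : z ∈ V, f z = w}`, computed in the extended reals
(`-∞` for an empty fiber). -/
noncomputable def fiberLogNorm {E F : Type*} [Norm E] [Norm F] (f : E → F) (V : Set E)
    (w : F) : EReal :=
  sSup ((fun z => elog ‖z‖) '' {z | z ∈ V ∧ f z = w})

/-- the order `ρ(f⁻¹, f(V))` of `f` on `V`: the growth exponent of the multifunction `f⁻¹`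
on `f(V)`. -/
noncomputable def orderExp {E F : Type*} [Norm E] [Norm F] (f : E → F) (V : Set E) : EReal :=
  Filter.limsup (fun w => fiberLogNorm f V w / elog ‖w‖) (atInftyOn (f '' V))

/-- the Łojasiewicz exponent at infinity `L∞(f|V)`, with `sup ∅ = -∞`. -/
noncomputable def lojExp {E F : Type*} [Norm E] [Norm F] (f : E → F) (V : Set E) : EReal :=
  sSup {x : EReal | ∃ d : ℝ, x = (d : EReal) ∧
    ∃ C : ℝ, 0 < C ∧ ∃ R : ℝ, 0 < R ∧ ∀ z ∈ V, R < ‖z‖ → C * ‖z‖ ^ d < ‖f z‖}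

/-- inverse on `[0,+∞] ⊆ EReal` with the conventions `1/∞ = 0` and `1/0 = ∞`. -/
noncomputable def invE (x : EReal) : EReal :=
  if x = ⊤ then 0 else if x = 0 then ⊤ else (((x.toReal)⁻¹ : ℝ) : EReal)

/-- evaluation of a polynomial of `n` variables at a point of `ℂⁿ`. -/
noncomputable def evalAt {n : ℕ} (z : EuclideanSpace ℂ (Fin n))
    (p : MvPolynomial (Fin n) ℂ) : ℂ :=
  MvPolynomial.eval (fun i => z i) p

/-- an algebraic subset of `ℂⁿ`: the common zero set of finitely many polynomials. -/
def IsAlgebraicSet {n : ℕ} (A : Set (EuclideanSpace ℂ (Fin n))) : Prop :=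
  ∃ S : Finset (MvPolynomial (Fin n) ℂ), A = {z | ∀ p ∈ S, evalAt z p = 0}

/-- the ideal of all polynomials vanishing identically on `A`. -/
noncomputable def vanishIdeal {n : ℕ} (A : Set (EuclideanSpace ℂ (Fin n))) :
    Ideal (MvPolynomial (Fin n) ℂ) :=
  RingHom.ker (Pi.ringHom fun z : A =>
    MvPolynomial.eval (fun i => (z : EuclideanSpace ℂ (Fin n)) i))

/-- a polynomial mapping on `A`: the restriction to `A` of a mapping all of whose
components are polynomials. -/
def IsPolyMapOn {N M : ℕ} (f : EuclideanSpace ℂ (Fin N) → EuclideanSpace ℂ (Fin M))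
    (A : Set (EuclideanSpace ℂ (Fin N))) : Prop :=
  ∃ P : Fin M → MvPolynomial (Fin N) ℂ, ∀ z ∈ A, ∀ j, f z j = evalAt z (P j)

/-- a holomorphic mapping on `A`: locally the restriction of a holomorphic mapping on an
open subset of the ambient space. -/
def IsHoloOn {N M : ℕ} (f : EuclideanSpace ℂ (Fin N) → EuclideanSpace ℂ (Fin M))
    (A : Set (EuclideanSpace ℂ (Fin N))) : Prop :=
  ∀ z ∈ A, ∃ U : Set (EuclideanSpace ℂ (Fin N)), IsOpen U ∧ z ∈ U ∧
    ∃ F : EuclideanSpace ℂ (Fin N) → EuclideanSpace ℂ (Fin M),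
      DifferentiableOn ℂ F U ∧ Set.EqOn f F (U ∩ A)

/-- the pluricomplex Green function of a compact set `K ⊆ ℂⁿ`, in its Siciak–Zaharjuta
polynomial form `V_K(z) = sup { (deg q)⁻¹ · log⁺ |q(z)| }`. -/
noncomputable def greenV {n : ℕ} (K : Set (EuclideanSpace ℂ (Fin n)))
    (z : EuclideanSpace ℂ (Fin n)) : EReal :=
  sSup {x : EReal | ∃ q : MvPolynomial (Fin n) ℂ, 1 ≤ q.totalDegree ∧
    (∀ w ∈ K, ‖evalAt w q‖ ≤ 1) ∧
    x = (((q.totalDegree : ℝ)⁻¹ * max (Real.log ‖evalAt z q‖) 0 : ℝ) : EReal)}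

open scoped Topology

theorem bw_entire_poly (φ : ℂ → ℂ) (hφ : Differentiable ℂ φ) (C : ℝ) (e : ℕ)
    (hC : ∀ t, ‖φ t‖ ≤ C * (1 + ‖t‖) ^ e) :
    (∀ t, φ t = ∑ n ∈ Finset.range (e + 1), (iteratedDeriv n φ 0 / (n.factorial : ℂ)) * t ^ n) ∧
    (∀ n, e < n → iteratedDeriv n φ 0 = 0) := by
  have h0 : ∀ n, e < n → iteratedDeriv n φ 0 = 0 := by
    intro n hn
    have key : ∀ R : ℝ, 1 ≤ R → ‖iteratedDeriv n φ 0‖ ≤ (n.factorial * (C * 2 ^ e)) * R⁻¹ := by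
      intro R hR
      have hR0 : 0 < R := by linarith
      have hC0 : 0 ≤ C := by
        have := (norm_nonneg _).trans (hC 0)
        simpa using this
      have := Complex.norm_iteratedDeriv_le_of_forall_mem_sphere_norm_le (c := 0) (R := R)
        (C := C * (2 * R) ^ e) n hR0 hφ.diffContOnCl (by
          intro z hz
          have hz' : ‖z‖ = R := by simpa using hz
          refine (hC z).trans ?_
          rw [hz']
          gcongr
          linarith)
      refine this.trans ?_
      rw [div_le_iff₀ (by positivity), mul_pow]
      have h1 : R ^ e ≤ R⁻¹ * R ^ n := by
        obtain ⟨k, rfl⟩ : ∃ k, n = e + 1 + k := ⟨n - (e+1), by omega⟩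
        have : R⁻¹ * R ^ (e + 1 + k) = R ^ e * R ^ k := by
          field_simp; ring
        rw [this]
        exact le_mul_of_one_le_right (by positivity) (one_le_pow₀ hR)
      calc (n.factorial : ℝ) * (C * (2 ^ e * R ^ e)) = (n.factorial * (C * 2 ^ e)) * R ^ e := by ring
        _ ≤ (n.factorial * (C * 2 ^ e)) * (R⁻¹ * R ^ n) := by gcongr
        _ = _ := by ring
    have hlim : Tendsto (fun R : ℝ => (n.factorial * (C * 2 ^ e)) * R⁻¹) atTop (𝓝 0) := by
      simpa using tendsto_inv_atTop_zero.const_mul ((n.factorial : ℝ) * (C * 2 ^ e))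
    have := ge_of_tendsto hlim ((eventually_ge_atTop 1).mono key)
    exact norm_le_zero_iff.mp this
  refine ⟨fun t => ?_, h0⟩
  have := Complex.hasSum_taylorSeries_of_entire hφ 0 t
  rw [← this.tsum_eq, tsum_eq_sum (s := Finset.range (e + 1))]
  · refine Finset.sum_congr rfl fun n _ => ?_
    simp only [sub_zero, smul_eq_mul]
    ring
  · intro n hn
    rw [h0 n (by simpa using hn)]
    simp

theorem bw_entire_bound (φ : ℂ → ℂ) (hφ : Differentiable ℂ φ) (C : ℝ) (e : ℕ)
    (hC : ∀ t, ‖φ t‖ ≤ C * (1 + ‖t‖) ^ e) (M r : ℝ) (hr : 0 < r)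
    (hM : ∀ t, ‖t‖ ≤ r → ‖φ t‖ ≤ M) :
    ‖φ 1‖ ≤ M * (e + 1) * (max 1 (1 / r)) ^ e := by
  obtain ⟨h1, -⟩ := bw_entire_poly φ hφ C e hC
  have hM0 : 0 ≤ M := (norm_nonneg _).trans (hM 0 (by simpa using hr.le))
  rw [h1 1]
  refine (norm_sum_le _ _).trans ?_
  have : ∀ n ∈ Finset.range (e + 1), ‖iteratedDeriv n φ 0 / (n.factorial : ℂ) * 1 ^ n‖ ≤
      M * (max 1 (1 / r)) ^ e := by
    intro n hn
    have := Complex.norm_iteratedDeriv_le_of_forall_mem_sphere_norm_le (c := 0) (R := r)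
        (C := M) n hr hφ.diffContOnCl (by
          intro z hz
          exact hM z (by simpa using hz.le))
    have hf : (0 : ℝ) < n.factorial := by positivity
    have h2 : ‖iteratedDeriv n φ 0 / (n.factorial : ℂ) * 1 ^ n‖ ≤ M * (1 / r) ^ n := by
      simp only [one_pow, mul_one, norm_div, Complex.norm_natCast]
      rw [div_le_iff₀ hf]
      refine this.trans (le_of_eq ?_)
      rw [one_div, inv_pow]
      field_simp
    refine h2.trans ?_
    gcongr
    calc (1 / r) ^ n ≤ (max 1 (1 / r)) ^ n := by gcongr; exact le_max_right _ _
      _ ≤ _ := pow_le_pow_right₀ (le_max_left _ _) (by simpa [Nat.lt_succ_iff] using hn)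
  refine (Finset.sum_le_sum this).trans (le_of_eq ?_)
  simp
  ring

theorem bw_removable (B : Finset ℂ) : ∀ (φ : ℂ → ℂ), (∀ t, t ∉ B → DifferentiableAt ℂ φ t) →
    (∀ c, ∃ K, ∀ᶠ t in 𝓝 c, t ∉ B → ‖φ t‖ ≤ K) →
    ∃ ψ : ℂ → ℂ, Differentiable ℂ ψ ∧ ∀ t, t ∉ B → ψ t = φ t := by
  classical
  induction B using Finset.induction_on with
  | empty =>
    intro φ h _
    exact ⟨φ, fun t => h t (by simp), fun _ _ => rfl⟩
  | insert β B hβ ih =>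
    intro φ h hb
    set φ' := Function.update φ β (limUnder (𝓝[≠] β) φ) with hφ'
    have hBc : (↑B : Set ℂ)ᶜ ∈ 𝓝 β := (B.finite_toSet.isClosed.isOpen_compl).mem_nhds (by simpa using hβ)
    have hd : ∀ t, t ∉ B → DifferentiableAt ℂ φ' t := by
      intro t ht
      by_cases htb : t = β
      · subst htb
        obtain ⟨K, hK⟩ := hb t
        have hs : ({u | u ∉ insert t B → ‖φ u‖ ≤ K} ∩ (↑B : Set ℂ)ᶜ) ∈ 𝓝 t := inter_mem hK hBc
        have := Complex.differentiableOn_update_limUnder_of_bddAbove (f := φ) hs (by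
          rintro u ⟨⟨_, hu⟩, hu'⟩
          refine (h u ?_).differentiableWithinAt
          simp only [Finset.mem_insert, not_or]
          exact ⟨hu', by simpa using hu⟩) (by
          refine ⟨K, ?_⟩
          rintro _ ⟨u, ⟨⟨hu, hu1⟩, hu2⟩, rfl⟩
          refine hu ?_
          simp only [Finset.mem_insert, not_or]
          exact ⟨hu2, by simpa using hu1⟩)
        exact this.differentiableAt hs
      · have : φ' =ᶠ[𝓝 t] φ := by
          filter_upwards [isOpen_ne.mem_nhds htb] with u hu
          simp [hφ', Function.update_of_ne hu]
        exact (this.differentiableAt_iff).2 (h t (by simp [htb, ht]))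
    obtain ⟨ψ, h1, h2⟩ := ih φ' hd (by
      intro c
      obtain ⟨K, hK⟩ := hb c
      refine ⟨max K ‖φ' β‖, ?_⟩
      filter_upwards [hK] with t ht htB
      by_cases htb : t = β
      · subst htb; exact le_max_right _ _
      · have : φ' t = φ t := by simp [hφ', Function.update_of_ne htb]
        rw [this]
        exact (ht (by simp [htb, htB])).trans (le_max_left _ _))
    refine ⟨ψ, h1, fun t ht => ?_⟩
    simp only [Finset.mem_insert, not_or] at ht
    rw [h2 t ht.2, hφ', Function.update_of_ne ht.1]

theorem bw_removable_growth (B : Finset ℂ) (φ : ℂ → ℂ) (h : ∀ t, t ∉ B → DifferentiableAt ℂ φ t)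
    (C : ℝ) (e : ℕ) (hC : ∀ t, t ∉ B → ‖φ t‖ ≤ C * (1 + ‖t‖) ^ e) :
    ∃ ψ : ℂ → ℂ, Differentiable ℂ ψ ∧ (∀ t, t ∉ B → ψ t = φ t) ∧
      ∀ t, ‖ψ t‖ ≤ C * (1 + ‖t‖) ^ e := by
  obtain ⟨ψ, h1, h2⟩ := bw_removable B φ h (by
    intro c
    refine ⟨C * (1 + ‖c‖) ^ e + 1, ?_⟩
    have hc : ContinuousAt (fun t : ℂ => C * (1 + ‖t‖) ^ e) c := by fun_prop
    have := hc.eventually (gt_mem_nhds (lt_add_one _))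
    filter_upwards [this] with t ht htB
    exact (hC t htB).trans ht.le)
  refine ⟨ψ, h1, h2, ?_⟩
  have hdense : Dense ((↑B : Set ℂ)ᶜ) := (B.finite_toSet.countable).dense_compl ℝ
  have hcl : IsClosed {t : ℂ | ‖ψ t‖ ≤ C * (1 + ‖t‖) ^ e} := by
    have := h1.continuous
    exact isClosed_le (by fun_prop) (by fun_prop)
  intro t
  have : closure ((↑B : Set ℂ)ᶜ) ⊆ {t : ℂ | ‖ψ t‖ ≤ C * (1 + ‖t‖) ^ e} := by
    refine closure_minimal ?_ hcl
    intro u hu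
    have hu' : u ∉ B := by simpa using hu
    simp only [Set.mem_ofPred_eq]
    rw [h2 u hu']; exact hC u hu'
  exact this (hdense t)

/-- three circles. -/
theorem bw_three_circles (ρ : ℝ) (hρ : 0 < ρ) (hρ1 : ρ < 1) :
    ∃ θ : ℝ, 0 < θ ∧ θ ≤ 1 ∧ ∃ K : ℝ, 1 ≤ K ∧ ∀ (f : ℂ → ℂ) (M₁ M₂ : ℝ), 0 < M₁ → 0 < M₂ →
      DifferentiableOn ℂ f (ball 0 (3 / 2)) → (∀ t, ‖t‖ ≤ ρ → ‖f t‖ ≤ M₁) →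
      (∀ t, ‖t‖ < 3 / 2 → ‖f t‖ ≤ M₂) → ‖f 1‖ ≤ K * (M₁ ^ θ * M₂ ^ (1 - θ)) := by
  -- choose θ with ρ^θ (5/4)^(1-θ) > 1
  have hcont : Continuous (fun θ : ℝ => ρ ^ θ * (5 / 4 : ℝ) ^ (1 - θ)) := by
    have h1 : Continuous (fun θ : ℝ => ρ ^ θ) := Real.continuous_const_rpow hρ.ne'
    have h2 : Continuous (fun θ : ℝ => (5 / 4 : ℝ) ^ (1 - θ)) :=
      (Real.continuous_const_rpow (by norm_num : (5 / 4 : ℝ) ≠ 0)).comp (by fun_prop)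
    exact h1.mul h2
  have hev : ∀ᶠ θ in 𝓝 (0 : ℝ), 1 < ρ ^ θ * (5 / 4 : ℝ) ^ (1 - θ) := by
    refine hcont.continuousAt.eventually (lt_mem_nhds ?_)
    norm_num
  obtain ⟨ε, hε, hball⟩ := Metric.eventually_nhds_iff.1 hev
  set θ := min (ε / 2) 1 with hθ
  have hθ0 : 0 < θ := by positivity
  have hθ1 : θ ≤ 1 := min_le_right _ _
  set w := ρ ^ θ * (5 / 4 : ℝ) ^ (1 - θ) with hw
  have hw1 : 1 < w := by
    apply hball
    rw [Real.dist_eq, sub_zero, abs_of_pos hθ0]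
    exact (min_le_left _ _).trans_lt (by linarith)
  refine ⟨θ, hθ0, hθ1, (1 - w⁻¹)⁻¹, ?_, ?_⟩
  · have h1 : 0 < w⁻¹ := by positivity
    have h2 : w⁻¹ < 1 := inv_lt_one_of_one_lt₀ hw1
    exact (one_le_inv₀ (by linarith)).2 (by linarith)
  intro f M₁ M₂ hM₁ hM₂ hf h1 h2
  have hw0 : 0 < w := by linarith
  have hsum := Complex.hasSum_taylorSeries_on_ball (c := 0) (r := (3 / 2)) (f := f) (z := 1) hf
    (by simp; norm_num)
  have hco : ∀ n : ℕ, ‖((n.factorial : ℂ))⁻¹ • (1 - 0 : ℂ) ^ n • iteratedDeriv n f 0‖ ≤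
      (M₁ ^ θ * M₂ ^ (1 - θ)) * (w⁻¹) ^ n := by
    intro n
    have hf0 : (0 : ℝ) < n.factorial := by positivity
    have ha := Complex.norm_iteratedDeriv_le_of_forall_mem_sphere_norm_le (c := 0) (R := ρ)
        (C := M₁) (f := f) n hρ (by
          apply DifferentiableOn.diffContOnCl
          refine hf.mono ?_
          refine closure_ball_subset_closedBall.trans (closedBall_subset_ball (by linarith)))
          (fun z hz => h1 z (by simpa using hz.le))
    have hb := Complex.norm_iteratedDeriv_le_of_forall_mem_sphere_norm_le (c := 0) (R := 5 / 4)
        (C := M₂) (f := f) n (by norm_num) (by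
          apply DifferentiableOn.diffContOnCl
          refine hf.mono ?_
          refine closure_ball_subset_closedBall.trans (closedBall_subset_ball (by norm_num)))
          (fun z hz => h2 z (by
            have : ‖z‖ = 5 / 4 := by simpa using hz
            rw [this]; norm_num))
    set a := ‖iteratedDeriv n f 0‖ / n.factorial with hadef
    have ha0 : 0 ≤ a := by positivity
    have ha' : a ≤ M₁ / ρ ^ n := by
      rw [hadef, div_le_iff₀ hf0]; refine ha.trans (le_of_eq ?_); ring
    have hb' : a ≤ M₂ / (5 / 4) ^ n := by
      rw [hadef, div_le_iff₀ hf0]; refine hb.trans (le_of_eq ?_); ring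
    have hn : ‖((n.factorial : ℂ))⁻¹ • (1 - 0 : ℂ) ^ n • iteratedDeriv n f 0‖ = a := by
      simp [hadef]; ring
    rw [hn]
    have : a = a ^ θ * a ^ (1 - θ) := by
      rcases ha0.eq_or_lt with h | h
      · rw [← h, Real.zero_rpow hθ0.ne']; simp
      · rw [← Real.rpow_add h]; simp
    rw [this]
    calc a ^ θ * a ^ (1 - θ) ≤ (M₁ / ρ ^ n) ^ θ * (M₂ / (5 / 4) ^ n) ^ (1 - θ) := by
          gcongr
      _ = _ := by
          rw [Real.div_rpow hM₁.le (by positivity), Real.div_rpow hM₂.le (by positivity),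
            ← Real.rpow_natCast, ← Real.rpow_natCast, ← Real.rpow_mul hρ.le,
            ← Real.rpow_mul (by norm_num), inv_pow, hw, mul_pow, ← Real.rpow_natCast (ρ ^ θ),
            ← Real.rpow_natCast ((5 / 4 : ℝ) ^ (1 - θ)), ← Real.rpow_mul hρ.le,
            ← Real.rpow_mul (by norm_num), mul_comm (n : ℝ), mul_comm (n : ℝ)]
          field_simp
  have hg : HasSum (fun n : ℕ => (M₁ ^ θ * M₂ ^ (1 - θ)) * (w⁻¹) ^ n)
      ((M₁ ^ θ * M₂ ^ (1 - θ)) * (1 - w⁻¹)⁻¹) :=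
    (hasSum_geometric_of_lt_one (by positivity) (inv_lt_one_of_one_lt₀ hw1)).mul_left _
  have := hsum.norm_le_of_bounded hg hco
  rw [mul_comm]; exact this

theorem bw_line {k : ℕ} (D : MvPolynomial (Fin k) ℂ) (x v : Fin k → ℂ) :
    ∃ p : Polynomial ℂ, ∀ t, p.eval t = eval (x + t • v) D := by
  refine ⟨aeval (fun i => Polynomial.C (x i) + Polynomial.C (v i) * Polynomial.X) D, fun t => ?_⟩
  induction D using MvPolynomial.induction_on with
  | C a => simp
  | add p q hp hq => simp [hp, hq]
  | mul_X p i hp => 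
    rw [map_mul, Polynomial.eval_mul, hp]
    simp only [aeval_X, Polynomial.eval_add, Polynomial.eval_C, Polynomial.eval_mul, Polynomial.eval_X,
      map_mul, eval_X, Pi.add_apply, Pi.smul_apply, smul_eq_mul]
    ring

theorem bw_line_finite {k : ℕ} (D : MvPolynomial (Fin k) ℂ) (x v : Fin k → ℂ) (h : eval x D ≠ 0) :
    ∃ B : Finset ℂ, ∀ t, t ∉ B ↔ eval (x + t • v) D ≠ 0 := by
  classical
  obtain ⟨p, hp⟩ := bw_line D x v
  have hp0 : p ≠ 0 := by
    rintro rfl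
    apply h
    have := hp 0
    simpa using this.symm
  refine ⟨p.roots.toFinset, fun t => ?_⟩
  simp [hp0, Polynomial.IsRoot, hp]

theorem bw_multilin_poly {k n : ℕ} (m : ContinuousMultilinearMap ℂ (fun _ : Fin n => (Fin k → ℂ)) ℂ)
    (x0 : Fin k → ℂ) :
    ∃ H : MvPolynomial (Fin k) ℂ, ∀ x, eval x H = m (fun _ => x - x0) := by
  classical
  refine ⟨∑ r : Fin n → Fin k, (∏ i, (X (r i) - C (x0 (r i)))) *
    C (m (fun i => Pi.single (r i) 1)), fun x => ?_⟩
  have hx : (fun _ : Fin n => x - x0) = fun _ : Fin n => ∑ j : Fin k, (x j - x0 j) • (Pi.single j 1 : Fin k → ℂ) := by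
    funext _
    funext l
    simp [Finset.sum_apply, Pi.single_apply]
  rw [hx, ContinuousMultilinearMap.map_sum]
  simp only [map_sum, map_mul, map_prod, map_sub, eval_X, eval_C]
  refine Finset.sum_congr rfl fun r _ => ?_
  rw [ContinuousMultilinearMap.map_smul_univ]
  simp

theorem bw_liouville_mv {k : ℕ} (g : (Fin k → ℂ) → ℂ) (D : MvPolynomial (Fin k) ℂ) (hD : D ≠ 0)
    (hg : ∀ x, eval x D ≠ 0 → AnalyticAt ℂ g x) (C : ℝ) (e : ℕ)
    (hC : ∀ x, eval x D ≠ 0 → ‖g x‖ ≤ C * (1 + ‖x‖) ^ e) :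
    ∃ H : MvPolynomial (Fin k) ℂ, ∀ x, eval x D ≠ 0 → eval x H = g x := by
  obtain ⟨x0, hx0⟩ : ∃ x0, eval x0 D ≠ 0 := by
    by_contra! h
    exact hD (MvPolynomial.funext (by simpa using h))
  have hC0 : 0 ≤ C := by
    have := (norm_nonneg _).trans (hC x0 hx0)
    by_contra! hc
    have h2 : C * (1 + ‖x0‖) ^ e < 0 := mul_neg_of_neg_of_pos hc (by positivity)
    linarith
  obtain ⟨p, hp⟩ := hg x0 hx0
  choose H hH using fun n => bw_multilin_poly (p n) x0
  refine ⟨∑ n ∈ Finset.range (e + 1), H n, fun x hx => ?_⟩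
  set v := x - x0 with hv
  obtain ⟨B, hB⟩ := bw_line_finite D x0 v hx0
  set φ : ℂ → ℂ := fun t => g (x0 + t • v) with hφ
  obtain ⟨ψ, h1, h2, h3⟩ := bw_removable_growth B φ (by
    intro t ht
    have := (hg _ ((hB t).1 ht)).differentiableAt
    exact DifferentiableAt.comp t this (by fun_prop)) (C * (1 + ‖x0‖ + ‖v‖) ^ e) e (by
    intro t ht
    refine (hC _ ((hB t).1 ht)).trans ?_
    rw [mul_assoc, ← mul_pow]
    gcongr
    have : ‖x0 + t • v‖ ≤ ‖x0‖ + ‖t‖ * ‖v‖ := (norm_add_le _ _).trans (by rw [norm_smul])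
    nlinarith [norm_nonneg x0, norm_nonneg t, norm_nonneg v, mul_nonneg (norm_nonneg x0) (norm_nonneg t)])
  obtain ⟨h4, h5⟩ := bw_entire_poly ψ h1 _ e h3
  -- power series
  let u : ℂ →L[ℂ] (Fin k → ℂ) := ContinuousLinearMap.toSpanSingleton ℂ v
  have hu : ∀ t, u t = t • v := fun t => rfl
  have hp' : HasFPowerSeriesAt (fun y => g (x0 + y)) p (u 0) := by
    have := hp.comp_sub (-x0)
    simp only [sub_neg_eq_add, add_neg_cancel] at this
    simpa [hu, add_comm] using this
  have hps : HasFPowerSeriesAt φ (p.compContinuousLinearMap u) 0 := hp'.compContinuousLinearMap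
  have hψan : HasFPowerSeriesAt ψ (p.compContinuousLinearMap u) 0 := by
    refine hps.congr ?_
    have : (↑B : Set ℂ)ᶜ ∈ 𝓝 (0:ℂ) := (B.finite_toSet.isClosed.isOpen_compl).mem_nhds (by
      have : (0:ℂ) ∉ B := (hB 0).2 (by simpa using hx0)
      simpa using this)
    filter_upwards [this] with t ht
    exact (h2 t (by simpa using ht)).symm
  have hcoef : ∀ n, iteratedDeriv n ψ 0 / (n.factorial : ℂ) = p n (fun _ => v) := by
    intro n
    have ha := h1.analyticAt 0
    have h6 := AnalyticAt.hasFPowerSeriesAt ha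
    have h7 := hψan.eq_formalMultilinearSeries h6
    have h8 := congrArg (fun q => q.coeff n) h7
    simp only [FormalMultilinearSeries.coeff_ofScalars] at h8
    rw [← h8]
    simp [FormalMultilinearSeries.coeff, FormalMultilinearSeries.compContinuousLinearMap]
    congr 1
    funext i
    simp [hu]
  have h1B : (1 : ℂ) ∉ B := (hB 1).2 (by simpa [hv] using hx)
  have hx1 : g x = ψ 1 := by rw [h2 1 h1B]; simp [hφ, hv]
  rw [hx1, h4 1, map_sum]
  refine Finset.sum_congr rfl fun n _ => ?_
  rw [hH, hcoef, one_pow, mul_one]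

theorem bw_hom_smul {k : ℕ} {F : MvPolynomial (Fin k) ℂ} {e : ℕ} (hF : F.IsHomogeneous e)
    (c : ℂ) (w : Fin k → ℂ) : eval (c • w) F = c ^ e * eval w F := by
  rw [eval_eq', eval_eq', Finset.mul_sum]
  refine Finset.sum_congr rfl fun d hd => ?_
  have h1 : ∑ i, d i = e := by
    have := hF (mem_support_iff.1 hd)
    rw [← this, Finsupp.weight_apply, Finsupp.sum_fintype] <;> simp
  simp only [Pi.smul_apply, smul_eq_mul, mul_pow]
  rw [Finset.prod_mul_distrib, Finset.prod_pow_eq_pow_sum, h1]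
  ring

theorem bw_growth {k : ℕ} (F : MvPolynomial (Fin k) ℂ) (e : ℕ) (he : F.totalDegree ≤ e) :
    ∃ C : ℝ, 0 < C ∧ ∀ z, ‖eval z F‖ ≤ C * (1 + ‖z‖) ^ e := by
  refine ⟨∑ d ∈ F.support, ‖coeff d F‖ + 1, by positivity, fun z => ?_⟩
  rw [eval_eq', add_mul, Finset.sum_mul]
  refine ((norm_sum_le _ _).trans (Finset.sum_le_sum fun d hd => ?_)).trans
    (le_add_of_nonneg_right (by positivity))
  rw [norm_mul, norm_prod]
  gcongr
  have h1 : ∑ i, d i ≤ e := by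
    have := (le_totalDegree hd).trans he
    rwa [Finsupp.sum_fintype _ _ (by simp)] at this
  calc ∏ i, ‖z i ^ d i‖ ≤ ∏ i, (1 + ‖z‖) ^ d i := by
        refine Finset.prod_le_prod (fun _ _ => norm_nonneg _) fun i _ => ?_
        rw [norm_pow]
        gcongr
        have := norm_le_pi_norm z i
        linarith
    _ = (1 + ‖z‖) ^ (∑ i, d i) := by rw [Finset.prod_pow_eq_pow_sum]
    _ ≤ _ := pow_le_pow_right₀ (by linarith [norm_nonneg z]) h1

theorem bw_integral_trans {S T R : Type*} [CommRing S] [CommRing T] [CommRing R]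
    (j : S →+* R) (j' : T →+* R) (hj : j.IsIntegral) (h : ∀ s, j'.IsIntegralElem (j s)) :
    j'.IsIntegral := by
  letI := j'.toAlgebra
  intro r
  obtain ⟨p, hp, hp0⟩ := hj r
  let jT : S →+* integralClosure T R := j.codRestrict (integralClosure T R) (fun s => h s)
  have h1 : IsIntegral (integralClosure T R) r := by
    refine ⟨p.map jT, hp.map _, ?_⟩
    rw [Polynomial.eval₂_map]
    exact hp0
  exact isIntegral_trans (R := T) r h1

noncomputable def bwPhi {k : ℕ} (v : Fin (k + 1) → ℂ) :
    MvPolynomial (Fin (k + 1)) ℂ →ₐ[ℂ] Polynomial (MvPolynomial (Fin k) ℂ) :=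
  aeval (Fin.cons Polynomial.X fun i : Fin k => Polynomial.C (X i) +
    Polynomial.C (C (v i.succ)) * Polynomial.X)

theorem bwPhi_X {k : ℕ} (v : Fin (k + 1) → ℂ) (hv : v 0 = 1) (i : Fin (k + 1)) :
    (bwPhi v (X i)).natDegree ≤ 1 ∧ (bwPhi v (X i)).coeff 1 = C (v i) := by
  refine Fin.cases ?_ (fun i => ?_) i
  · simp [bwPhi, hv, Polynomial.natDegree_X_le]
  · simp only [bwPhi, aeval_X, Fin.cons_succ]
    constructor
    · compute_degree
    · simp [Polynomial.coeff_C]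

theorem bwPhi_monomial {k : ℕ} (v : Fin (k + 1) → ℂ) (hv : v 0 = 1) (s : Fin (k + 1) →₀ ℕ) (a : ℂ) :
    ∃ d, (monomial s a).IsHomogeneous d ∧ (bwPhi v (monomial s a)).natDegree ≤ d ∧
      (bwPhi v (monomial s a)).coeff d = C (eval v (monomial s a)) := by
  refine induction_on_monomial (motive := fun p => ∃ d, p.IsHomogeneous d ∧
    (bwPhi v p).natDegree ≤ d ∧ (bwPhi v p).coeff d = C (eval v p)) ?_ ?_ s a
  · intro a
    have : bwPhi v (C a) = Polynomial.C (C a) := by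
      simp [bwPhi]
    refine ⟨0, isHomogeneous_C _ _, ?_, ?_⟩
    · rw [this]; simp
    · rw [this]; simp
  · rintro p i ⟨d, h1, h2, h3⟩
    obtain ⟨h4, h5⟩ := bwPhi_X v hv i
    refine ⟨d + 1, h1.mul (isHomogeneous_X _ _), ?_, ?_⟩
    · rw [map_mul]
      exact Polynomial.natDegree_mul_le.trans (add_le_add h2 h4)
    · rw [map_mul, Polynomial.coeff_mul_add_eq_of_natDegree_le h2 h4, h3, h5]
      simp

theorem bwPhi_hom {k : ℕ} (v : Fin (k + 1) → ℂ) (hv : v 0 = 1) (F : MvPolynomial (Fin (k + 1)) ℂ)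
    (d : ℕ) (hF : F.IsHomogeneous d) :
    (bwPhi v F).natDegree ≤ d ∧ (bwPhi v F).coeff d = C (eval v F) := by
  have hF' : F = ∑ s ∈ F.support, monomial s (coeff s F) := F.as_sum
  have key : ∀ s ∈ F.support, (bwPhi v (monomial s (coeff s F))).natDegree ≤ d ∧
      (bwPhi v (monomial s (coeff s F))).coeff d = C (eval v (monomial s (coeff s F))) := by
    intro s hs
    obtain ⟨d', h1, h2, h3⟩ := bwPhi_monomial v hv s (coeff s F)
    have hne := mem_support_iff.1 hs
    have h4 : d' = d := by
      have e1 := h1 (d := s) (by simpa using hne)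
      have e2 := hF hne
      rw [← e1, ← e2]
    subst h4
    exact ⟨h2, h3⟩
  rw [hF']
  simp only [map_sum, Polynomial.finsetSum_coeff]
  exact ⟨Polynomial.natDegree_sum_le_of_forall_le _ _ fun s hs => (key s hs).1,
    Finset.sum_congr rfl fun s hs => (key s hs).2⟩

theorem bwPhi_eval {k : ℕ} (v : Fin (k + 1) → ℂ) (F : MvPolynomial (Fin (k + 1)) ℂ) {R : Type*}
    [CommRing R] [Algebra ℂ R] (y : Fin k → R) (w : Fin (k + 1) → R)
    (hw : ∀ i : Fin k, w i.succ = y i + algebraMap ℂ R (v i.succ) * w 0) :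
    (bwPhi v F).eval₂ (aeval y).toRingHom (w 0) = aeval w F := by
  induction F using MvPolynomial.induction_on with
  | C a =>
    have : bwPhi v (C a) = Polynomial.C (C a) := by
      simp [bwPhi]
    rw [this]; simp
  | add p q hp hq => rw [map_add, Polynomial.eval₂_add, hp, hq, map_add]
  | mul_X p i hp =>
    rw [map_mul, Polynomial.eval₂_mul, hp, map_mul]
    congr 1
    refine Fin.cases ?_ (fun i => ?_) i
    · simp [bwPhi]
    · simp [bwPhi, hw]

/-- the map given by a family of polynomials. -/
noncomputable def bwPi {N k : ℕ} (P : Fin k → MvPolynomial (Fin N) ℂ) (z : Fin N → ℂ) : Fin k → ℂ :=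
  fun j => eval z (P j)

def bwNN {N : ℕ} (A : Set (Fin N → ℂ)) (I : Ideal (MvPolynomial (Fin N) ℂ)) (k : ℕ) : Prop :=
  ∃ P : Fin k → MvPolynomial (Fin N) ℂ,
    (∃ C : ℝ, ∀ z ∈ A, 1 + ‖z‖ ≤ C * (1 + ‖bwPi P z‖)) ∧
    (∃ C : ℝ, ∀ z, 1 + ‖bwPi P z‖ ≤ C * (1 + ‖z‖)) ∧
    (aeval (fun j => Ideal.Quotient.mk I (P j)) :
      MvPolynomial (Fin k) ℂ →ₐ[ℂ] (MvPolynomial (Fin N) ℂ ⧸ I)).toRingHom.IsIntegral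

theorem bwNN_start {N : ℕ} (A : Set (Fin N → ℂ)) (I : Ideal (MvPolynomial (Fin N) ℂ)) :
    bwNN A I N := by
  have h : ∀ z : Fin N → ℂ, bwPi (fun j => X j) z = z := by
    intro z; funext j; simp [bwPi]
  refine ⟨fun j => X j, ⟨1, fun z _ => by rw [h]; simp⟩, ⟨1, fun z => by rw [h]; simp⟩, ?_⟩
  apply RingHom.isIntegral_of_surjective
  intro r
  obtain ⟨p, rfl⟩ := Ideal.Quotient.mk_surjective r
  refine ⟨p, ?_⟩
  have : (aeval (fun j => Ideal.Quotient.mk I (X j)) : MvPolynomial (Fin N) ℂ →ₐ[ℂ] _) =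
      Ideal.Quotient.mkₐ ℂ I := by
    ext j; simp
  exact congrArg (fun g => g p) this

theorem bw_top_bound {k : ℕ} (F : MvPolynomial (Fin (k + 1)) ℂ) (e : ℕ) (he : F.totalDegree = e + 1)
    (v : Fin (k + 1) → ℂ) (hv0 : v 0 = 1)
    (hv : eval v (homogeneousComponent (e + 1) F) ≠ 0) :
    ∃ C : ℝ, 0 < C ∧ ∀ (w : Fin (k + 1) → ℂ) (y : Fin k → ℂ),
      (∀ i : Fin k, w i.succ = y i + v i.succ * w 0) → eval w F = 0 → ‖w 0‖ ≤ C * (1 + ‖y‖) := by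
  set T := homogeneousComponent (e + 1) F with hT
  have hThom : T.IsHomogeneous (e + 1) := homogeneousComponent_isHomogeneous _ _
  set G := ∑ i ∈ Finset.range (e + 1), homogeneousComponent i F with hG
  have hFG : F = G + T := by
    conv_lhs => rw [← sum_homogeneousComponent F, he, Finset.sum_range_succ]
  have hGd : G.totalDegree ≤ e := by
    refine totalDegree_finsetSum_le fun i hi => ?_
    have := (homogeneousComponent_isHomogeneous i F).totalDegree_le
    have := Finset.mem_range.1 hi
    omega
  obtain ⟨C1, hC1, hb⟩ := bw_growth G e hGd
  have hcont : Continuous (fun u => ‖eval u T‖) := by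
    have := MvPolynomial.continuous_eval T
    fun_prop
  have hev := hcont.continuousAt.eventually (lt_mem_nhds (show ‖eval v T‖ / 2 < ‖eval v T‖ by
    have := norm_pos_iff.2 hv; linarith))
  obtain ⟨ε, hε, hball⟩ := Metric.eventually_nhds_iff.1 hev
  set c := ‖eval v T‖ / 2 with hc
  have hc0 : 0 < c := by have := norm_pos_iff.2 hv; positivity
  set K := 2 + ‖v‖ + ε with hK
  have hK0 : 0 < K := by positivity
  refine ⟨1 + 2 / ε + C1 * K ^ e / c, by positivity, fun w y hw hFw => ?_⟩
  have hy0 := norm_nonneg y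
  by_contra! hlt
  have hpos1 : 0 ≤ 2 / ε := by positivity
  have hpos2 : 0 ≤ C1 * K ^ e / c := by positivity
  have hw1 : 1 < ‖w 0‖ := by nlinarith
  have hwy : ‖y‖ < ε * ‖w 0‖ := by
    have : 2 / ε * (1 + ‖y‖) < ‖w 0‖ := by nlinarith
    have h2 := mul_lt_mul_of_pos_left this hε
    have h3 : ε * (2 / ε * (1 + ‖y‖)) = 2 * (1 + ‖y‖) := by field_simp
    linarith
  have hwc : C1 * K ^ e / c < ‖w 0‖ := by nlinarith
  have hw0 : w 0 ≠ 0 := by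
    intro h; rw [h] at hw1; simp at hw1; linarith
  set t := w 0 with ht
  set u := t⁻¹ • w with hu
  have hwu : w = t • u := by rw [hu, smul_smul, mul_inv_cancel₀ hw0, one_smul]
  have huv : ‖u - v‖ < ε := by
    rw [pi_norm_lt_iff hε]
    intro i
    refine Fin.cases ?_ (fun i => ?_) i
    · simp only [hu, Pi.sub_apply, Pi.smul_apply, smul_eq_mul, hv0, ← ht, inv_mul_cancel₀ hw0,
        sub_self, norm_zero]
      exact hε
    · have : (u - v) i.succ = t⁻¹ * y i := by
        simp only [hu, Pi.sub_apply, Pi.smul_apply, smul_eq_mul, hw]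
        field_simp; ring
      rw [this, norm_mul, norm_inv, inv_mul_lt_iff₀ (by positivity)]
      refine (norm_le_pi_norm y i).trans_lt ?_
      linarith
  have h1 : c < ‖eval u T‖ := hball (by rw [dist_eq_norm]; exact huv)
  have h2 : eval w T = t ^ (e + 1) * eval u T := by rw [hwu, bw_hom_smul hThom]
  have h3 : ‖eval w T‖ ≤ C1 * (1 + ‖w‖) ^ e := by
    have : eval w T = - eval w G := by
      rw [hFG, map_add] at hFw
      linear_combination hFw
    rw [this, norm_neg]; exact hb w
  have h4 : 1 + ‖w‖ ≤ K * ‖t‖ := by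
    have hu' : ‖u‖ ≤ ‖v‖ + ε := by
      have := norm_add_le v (u - v)
      rw [add_sub_cancel] at this
      linarith
    have : ‖w‖ = ‖t‖ * ‖u‖ := by rw [hwu, norm_smul]
    rw [this]
    nlinarith [norm_nonneg t, norm_nonneg u]
  have h5 : ‖t‖ ^ (e + 1) * c ≤ C1 * K ^ e * ‖t‖ ^ e := by
    calc ‖t‖ ^ (e + 1) * c ≤ ‖t‖ ^ (e + 1) * ‖eval u T‖ := by gcongr
      _ = ‖eval w T‖ := by rw [h2, norm_mul, norm_pow]
      _ ≤ C1 * (K * ‖t‖) ^ e := h3.trans (by gcongr)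
      _ = _ := by rw [mul_pow]; ring
  have hte : 0 < ‖t‖ ^ e := by positivity
  have h6 : ‖t‖ * c ≤ C1 * K ^ e := by
    have : ‖t‖ ^ e * (‖t‖ * c) ≤ ‖t‖ ^ e * (C1 * K ^ e) := by
      rw [pow_succ] at h5; linarith
    exact le_of_mul_le_mul_left this hte
  rw [div_lt_iff₀ hc0] at hwc
  linarith

theorem bwNN_step {N : ℕ} (A : Set (Fin N → ℂ)) (hA : A.Nonempty) (I : Ideal (MvPolynomial (Fin N) ℂ))
    (hI : ∀ p, p ∈ I ↔ ∀ z ∈ A, eval z p = 0) (k : ℕ) (P : Fin (k + 1) → MvPolynomial (Fin N) ℂ)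
    (h1 : ∃ C : ℝ, ∀ z ∈ A, 1 + ‖z‖ ≤ C * (1 + ‖bwPi P z‖))
    (h2 : ∃ C : ℝ, ∀ z, 1 + ‖bwPi P z‖ ≤ C * (1 + ‖z‖))
    (h3 : (aeval (fun j => Ideal.Quotient.mk I (P j)) :
      MvPolynomial (Fin (k + 1)) ℂ →ₐ[ℂ] (MvPolynomial (Fin N) ℂ ⧸ I)).toRingHom.IsIntegral)
    (F : MvPolynomial (Fin (k + 1)) ℂ) (hF : F ≠ 0) (hFA : ∀ z ∈ A, eval (bwPi P z) F = 0) :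
    bwNN A I k := by
  obtain ⟨a, ha⟩ := hA
  obtain ⟨e, he⟩ : ∃ e, F.totalDegree = e + 1 := by
    rcases Nat.exists_eq_succ_of_ne_zero (n := F.totalDegree) (by
      intro h0
      have := (totalDegree_eq_zero_iff_eq_C).1 h0
      have h4 := hFA a ha
      rw [this] at h4
      simp at h4
      rw [h4] at this
      exact hF (by simpa using this)) with ⟨e, he⟩
    exact ⟨e, he⟩
  set T := homogeneousComponent (e + 1) F with hT
  have hThom : T.IsHomogeneous (e + 1) := homogeneousComponent_isHomogeneous _ _
  have hT0 : T ≠ 0 := by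
    intro h0
    have : F = ∑ i ∈ Finset.range (e + 1), homogeneousComponent i F := by
      conv_lhs => rw [← sum_homogeneousComponent F, he, Finset.sum_range_succ, ← hT, h0, add_zero]
    have h5 : F.totalDegree ≤ e := by
      rw [this]
      refine totalDegree_finsetSum_le fun i hi => ?_
      have := (homogeneousComponent_isHomogeneous i F).totalDegree_le
      have := Finset.mem_range.1 hi
      omega
    omega
  obtain ⟨v, hv0, hv⟩ : ∃ v : Fin (k + 1) → ℂ, v 0 = 1 ∧ eval v T ≠ 0 := by
    obtain ⟨u, hu⟩ : ∃ u, eval u (X 0 * T) ≠ 0 := by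
      by_contra! h
      exact (mul_ne_zero (X_ne_zero 0) hT0) (MvPolynomial.funext (by simpa using h))
    rw [map_mul, eval_X] at hu
    refine ⟨(u 0)⁻¹ • u, ?_, ?_⟩
    · simp [inv_mul_cancel₀ (left_ne_zero_of_mul hu)]
    · rw [bw_hom_smul hThom]
      exact mul_ne_zero (pow_ne_zero _ (inv_ne_zero (left_ne_zero_of_mul hu))) (right_ne_zero_of_mul hu)
  set P' : Fin k → MvPolynomial (Fin N) ℂ := fun i => P i.succ - C (v i.succ) * P 0 with hP'
  have hPP' : ∀ z i, bwPi P z i.succ = bwPi P' z i + v i.succ * bwPi P z 0 := by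
    intro z i; simp [bwPi, hP']
  obtain ⟨C1, hC1⟩ := h1
  obtain ⟨C2, hC2⟩ := h2
  obtain ⟨C3, hC30, hC3⟩ := bw_top_bound F e he v hv0 hv
  have hC1' : 0 ≤ C1 := by
    by_contra! h
    have := hC1 a ha
    nlinarith [norm_nonneg a, norm_nonneg (bwPi P a)]
  refine ⟨P', ⟨C1 * (1 + C3 + ‖v‖ * C3), fun z hz => ?_⟩, ⟨(1 + ‖v‖) * C2, fun z => ?_⟩, ?_⟩
  · refine (hC1 z hz).trans ?_
    rw [mul_assoc]
    gcongr
    have h0 := hC3 _ _ (hPP' z) (hFA z hz)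
    have hy := norm_nonneg (bwPi P' z)
    have hvn := norm_nonneg v
    have : ‖bwPi P z‖ ≤ ‖bwPi P' z‖ + (1 + ‖v‖) * ‖bwPi P z 0‖ := by
      rw [pi_norm_le_iff_of_nonneg (by positivity)]
      intro i
      refine Fin.cases ?_ (fun i => ?_) i
      · nlinarith [norm_nonneg (bwPi P z 0)]
      · rw [hPP']
        refine (norm_add_le _ _).trans ?_
        rw [norm_mul]
        have e1 := norm_le_pi_norm (bwPi P' z) i
        have e2 := norm_le_pi_norm v i.succ
        nlinarith [norm_nonneg (bwPi P z 0)]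
    nlinarith
  · have : ‖bwPi P' z‖ ≤ (1 + ‖v‖) * ‖bwPi P z‖ := by
      rw [pi_norm_le_iff_of_nonneg (by positivity)]
      intro i
      have : bwPi P' z i = bwPi P z i.succ - v i.succ * bwPi P z 0 := by rw [hPP']; ring
      rw [this]
      refine (norm_sub_le _ _).trans ?_
      rw [norm_mul]
      have e1 := norm_le_pi_norm (bwPi P z) i.succ
      have e2 := norm_le_pi_norm v i.succ
      have e3 := norm_le_pi_norm (bwPi P z) 0
      have := mul_le_mul e2 e3 (norm_nonneg _) (norm_nonneg _)
      linarith
    have h4 := hC2 z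
    nlinarith [norm_nonneg v, norm_nonneg (bwPi P z)]
  · set R := MvPolynomial (Fin N) ℂ ⧸ I
    set w : Fin (k + 1) → R := fun j => Ideal.Quotient.mk I (P j) with hw
    set y : Fin k → R := fun j => Ideal.Quotient.mk I (P' j) with hy
    have hwy : ∀ i : Fin k, w i.succ = y i + algebraMap ℂ R (v i.succ) * w 0 := by
      intro i
      have : algebraMap ℂ R (v i.succ) = Ideal.Quotient.mk I (C (v i.succ)) := rfl
      rw [this]
      simp only [hw, hy, hP', ← map_mul, ← map_add]
      congr 1; ring
    have hFw : aeval w F = 0 := by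
      have : aeval w F = Ideal.Quotient.mk I (aeval P F) := by
        have h := MvPolynomial.map_aeval P (Ideal.Quotient.mk I) F
        rw [h]; rfl
      rw [this, Ideal.Quotient.eq_zero_iff_mem, hI]
      intro z hz
      have h5 := MvPolynomial.map_aeval P (eval z) F
      rw [h5, ← hFA z hz]
      change eval₂Hom _ _ F = eval₂Hom _ _ F
      congr 2
      ext; simp
    have hintg0 : (aeval y : MvPolynomial (Fin k) ℂ →ₐ[ℂ] R).toRingHom.IsIntegralElem (w 0) := by
      set c := eval v T with hc
      have hco : (bwPhi v F).coeff (e + 1) = C c ∧ (bwPhi v F).natDegree ≤ e + 1 := by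
        have hFG : F = ∑ i ∈ Finset.range (e + 1), homogeneousComponent i F + T := by
          conv_lhs => rw [← sum_homogeneousComponent F, he, Finset.sum_range_succ]
        have hd : (bwPhi v (∑ i ∈ Finset.range (e + 1), homogeneousComponent i F)).natDegree ≤ e := by
          rw [map_sum]
          refine Polynomial.natDegree_sum_le_of_forall_le _ _ fun i hi => ?_
          have := (bwPhi_hom v hv0 _ i (homogeneousComponent_isHomogeneous i F)).1
          have := Finset.mem_range.1 hi
          omega
        obtain ⟨h6, h7⟩ := bwPhi_hom v hv0 T _ hThom
        rw [hFG, map_add]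
        constructor
        · rw [Polynomial.coeff_add, h7, Polynomial.coeff_eq_zero_of_natDegree_lt (by omega), zero_add]
        · exact (Polynomial.natDegree_add_le _ _).trans (max_le (by omega) h6)
      refine ⟨Polynomial.C (C c⁻¹) * bwPhi v F, ?_, ?_⟩
      · refine Polynomial.monic_of_natDegree_le_of_coeff_eq_one (e + 1) ?_ ?_
        · exact (Polynomial.natDegree_C_mul_le _ _).trans hco.2
        · rw [Polynomial.coeff_C_mul, hco.1, ← C_mul, inv_mul_cancel₀ hv, C_1]
      · rw [Polynomial.eval₂_mul, bwPhi_eval v F y w hwy, hFw, mul_zero]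
    refine bw_integral_trans _ _ h3 fun s => ?_
    induction s using MvPolynomial.induction_on with
    | C a =>
      have : (aeval w : MvPolynomial (Fin (k+1)) ℂ →ₐ[ℂ] R).toRingHom (C a) =
        (aeval y : MvPolynomial (Fin k) ℂ →ₐ[ℂ] R).toRingHom (C a) := by simp
      rw [this]
      exact RingHom.isIntegralElem_map _
    | add p q hp hq => rw [map_add]; exact RingHom.IsIntegralElem.add _ hp hq
    | mul_X p i hp =>
      rw [map_mul]
      refine RingHom.IsIntegralElem.mul _ hp ?_
      have : (aeval w : MvPolynomial (Fin (k+1)) ℂ →ₐ[ℂ] R).toRingHom (X i) = w i := by simp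
      rw [this]
      refine Fin.cases hintg0 (fun i => ?_) i
      rw [hwy]
      refine RingHom.IsIntegralElem.add _ ?_ (RingHom.IsIntegralElem.mul _ ?_ hintg0)
      · have : y i = (aeval y : MvPolynomial (Fin k) ℂ →ₐ[ℂ] R).toRingHom (X i) := by simp
        rw [this]; exact RingHom.isIntegralElem_map _
      · have : algebraMap ℂ R (v i.succ) = (aeval y : MvPolynomial (Fin k) ℂ →ₐ[ℂ] R).toRingHom (C (v i.succ)) := by simp
        rw [this]; exact RingHom.isIntegralElem_map _

theorem bwNN_exists {N : ℕ} (A : Set (Fin N → ℂ)) (hA : A.Nonempty) (I : Ideal (MvPolynomial (Fin N) ℂ))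
    (hI : ∀ p, p ∈ I ↔ ∀ z ∈ A, eval z p = 0) :
    ∃ (k : ℕ) (P : Fin k → MvPolynomial (Fin N) ℂ),
    (∃ C : ℝ, ∀ z ∈ A, 1 + ‖z‖ ≤ C * (1 + ‖bwPi P z‖)) ∧
    (∃ C : ℝ, ∀ z, 1 + ‖bwPi P z‖ ≤ C * (1 + ‖z‖)) ∧
    (aeval (fun j => Ideal.Quotient.mk I (P j)) :
      MvPolynomial (Fin k) ℂ →ₐ[ℂ] (MvPolynomial (Fin N) ℂ ⧸ I)).toRingHom.IsIntegral ∧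
    (∀ F : MvPolynomial (Fin k) ℂ, (∀ z ∈ A, eval (bwPi P z) F = 0) → F = 0) := by
  classical
  have hex : ∃ k, bwNN A I k := ⟨N, bwNN_start A I⟩
  obtain ⟨P, h1, h2, h3⟩ := Nat.find_spec hex
  refine ⟨Nat.find hex, P, h1, h2, h3, fun F hF => ?_⟩
  by_contra hF0
  have hmin := fun m (hm : m < Nat.find hex) => Nat.find_min hex hm
  generalize Nat.find hex = k at *
  cases k with
  | zero =>
    obtain ⟨a, ha⟩ := hA
    apply hF0
    apply MvPolynomial.funext
    intro x
    rw [Subsingleton.elim x (bwPi P a), hF a ha, map_zero]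
  | succ k => exact hmin k (Nat.lt_succ_self k) (bwNN_step A hA I hI k P h1 h2 h3 F hF0 hF)

theorem bw_clear {S K : Type*} [CommRing S] [IsDomain S] [Field K] [Algebra S K] [IsFractionRing S K]
    (p : Polynomial K) : ∃ d : S, d ≠ 0 ∧ ∃ q : Polynomial S,
      q.map (algebraMap S K) = Polynomial.C (algebraMap S K d) * p := by
  obtain ⟨b, hb0, hb⟩ := IsLocalization.integerNormalization_spec (nonZeroDivisors S) p
  refine ⟨b, nonZeroDivisors.ne_zero hb0, _, hb.trans ?_⟩
  rw [Polynomial.C_mul', ← algebraMap_smul K]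

theorem bw_prim {S R : Type*} [CommRing S] [IsDomain S] [IsIntegrallyClosed S] [CharZero S]
    [CommRing R] [IsDomain R] [Algebra S R] [Module.Finite S R] [FaithfulSMul S R] :
    ∃ ℓ : R, (∃ D : S, D ≠ 0 ∧ ∃ a b : Polynomial S,
        a * minpoly S ℓ + b * (minpoly S ℓ).derivative = Polynomial.C D) ∧
      ∀ r : R, ∃ D : S, D ≠ 0 ∧ ∃ g : Polynomial S, algebraMap S R D * r = Polynomial.aeval ℓ g := by
  let K := FractionRing S
  let L := FractionRing R
  let _ : Algebra K L := FractionRing.liftAlgebra S L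
  have inst1 : FiniteDimensional K L := inferInstance
  have inst2 : CharZero K := charZero_of_injective_algebraMap (IsFractionRing.injective S K)
  have injRL := IsFractionRing.injective R L
  have injSK := IsFractionRing.injective S K
  have int : Algebra.IsIntegral S R := inferInstance
  obtain ⟨α, hα⟩ := Field.exists_primitive_element K L
  obtain ⟨a, b, hb, rfl⟩ := IsFractionRing.div_surjective (A := R) α
  obtain ⟨s, hs, c, hc⟩ := (int.1 b).isAlgebraic.exists_nonzero_dvd hb
  have hb0 : algebraMap R L b ≠ 0 := by
    simpa using nonZeroDivisors.ne_zero hb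
  have tow : ∀ s : S, algebraMap K L (algebraMap S K s) = algebraMap R L (algebraMap S R s) := by
    intro s
    rw [← IsScalarTower.algebraMap_apply S K L, ← IsScalarTower.algebraMap_apply S R L]
  have hs0 : algebraMap S K s ≠ 0 := by simpa using hs
  set ℓ : R := a * c with hℓ
  have hℓα : algebraMap R L a / algebraMap R L b =
      algebraMap K L (algebraMap S K s)⁻¹ * algebraMap R L ℓ := by
    have hx : algebraMap K L (algebraMap S K s) ≠ 0 := by
      simpa using hs0
    rw [map_inv₀]
    rw [div_eq_iff hb0, mul_assoc, inv_mul_eq_div, eq_div_iff hx]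
    rw [tow, hc, hℓ, map_mul, map_mul]; ring
  have htop : IntermediateField.adjoin K {algebraMap R L ℓ} = ⊤ := by
    rw [eq_top_iff, ← hα, IntermediateField.adjoin_simple_le_iff, hℓα]
    exact mul_mem (IntermediateField.algebraMap_mem _ _) (IntermediateField.mem_adjoin_simple_self _ _)
  have hintg : IsIntegral K (algebraMap R L ℓ) := Algebra.IsIntegral.isIntegral _
  have hmin : minpoly K (algebraMap R L ℓ) = (minpoly S ℓ).map (algebraMap S K) :=
    minpoly.isIntegrallyClosed_eq_field_fractions K L (int.1 ℓ)
  refine ⟨ℓ, ?_, ?_⟩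
  · have hsep : (minpoly K (algebraMap R L ℓ)).Separable :=
      (minpoly.irreducible hintg).separable
    rw [hmin] at hsep
    obtain ⟨u, v, huv⟩ := hsep
    obtain ⟨d1, hd1, q1, hq1⟩ := bw_clear (S := S) u
    obtain ⟨d2, hd2, q2, hq2⟩ := bw_clear (S := S) v
    refine ⟨d1 * d2, mul_ne_zero hd1 hd2, Polynomial.C d2 * q1, Polynomial.C d1 * q2, ?_⟩
    apply Polynomial.map_injective _ injSK
    rw [Polynomial.derivative_map] at huv
    simp only [Polynomial.map_add, Polynomial.map_mul, Polynomial.map_C, hq1, hq2, map_mul]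
    linear_combination (Polynomial.C (algebraMap S K d1) * Polynomial.C (algebraMap S K d2)) * huv
  · intro r
    have hr : algebraMap R L r ∈ (IntermediateField.adjoin K {algebraMap R L ℓ}).toSubalgebra := by
      rw [htop]; trivial
    rw [IntermediateField.adjoin_simple_toSubalgebra_of_isAlgebraic hintg.isAlgebraic,
      Algebra.adjoin_singleton_eq_range_aeval] at hr
    obtain ⟨p, hp⟩ := hr
    obtain ⟨d, hd, q, hq⟩ := bw_clear (S := S) p
    refine ⟨d, hd, q, injRL ?_⟩
    have h1 := congrArg (Polynomial.aeval (algebraMap R L ℓ)) hq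
    rw [Polynomial.aeval_map_algebraMap, Polynomial.aeval_algebraMap_apply, map_mul,
      Polynomial.aeval_C, tow] at h1
    rw [h1, map_mul]
    congr 1
    exact hp.symm

/-- evaluation of a polynomial with polynomial coefficients. -/
noncomputable def bwEv {k : ℕ} (p : Polynomial (MvPolynomial (Fin k) ℂ)) (x : Fin k → ℂ) (τ : ℂ) : ℂ :=
  Polynomial.eval₂ (eval x) τ p

/-- Noether data of an irreducible algebraic set. -/
structure BWData {N : ℕ} (A : Set (Fin N → ℂ)) where
  k : ℕ
  P : Fin k → MvPolynomial (Fin N) ℂ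
  lower : ∃ C : ℝ, ∀ z ∈ A, 1 + ‖z‖ ≤ C * (1 + ‖bwPi P z‖)
  upper : ∃ C : ℝ, ∀ z, 1 + ‖bwPi P z‖ ≤ C * (1 + ‖z‖)
  inj : ∀ F, (∀ z ∈ A, eval (bwPi P z) F = 0) → F = 0
  s : ℕ
  lift : ∀ r : MvPolynomial (Fin N) ℂ, ∃ χ : Polynomial (MvPolynomial (Fin k) ℂ), χ.Monic ∧
    χ.natDegree ≤ s ∧ (∀ z ∈ A, bwEv χ (bwPi P z) (eval z r) = 0) ∧
    ∀ x τ, bwEv χ x τ = 0 → ∃ z ∈ A, bwPi P z = x ∧ eval z r = τ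
  l : MvPolynomial (Fin N) ℂ
  χ : Polynomial (MvPolynomial (Fin k) ℂ)
  monic : χ.Monic
  root : ∀ z ∈ A, bwEv χ (bwPi P z) (eval z l) = 0
  surj : ∀ x τ, bwEv χ x τ = 0 → ∃ z ∈ A, bwPi P z = x ∧ eval z l = τ
  D : MvPolynomial (Fin k) ℂ
  D0 : D ≠ 0
  sep : ∀ x τ, eval x D ≠ 0 → bwEv χ x τ = 0 → bwEv χ.derivative x τ ≠ 0
  g : Fin N → Polynomial (MvPolynomial (Fin k) ℂ)
  hg : ∀ z ∈ A, ∀ i, eval (bwPi P z) D * z i = bwEv (g i) (bwPi P z) (eval z l)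

theorem bwData_of {N : ℕ} (A : Set (Fin N → ℂ)) {k : ℕ} (P : Fin k → MvPolynomial (Fin N) ℂ)
    (hlow : ∃ C : ℝ, ∀ z ∈ A, 1 + ‖z‖ ≤ C * (1 + ‖bwPi P z‖))
    (hup : ∃ C : ℝ, ∀ z, 1 + ‖bwPi P z‖ ≤ C * (1 + ‖z‖))
    (hinj : ∀ F, (∀ z ∈ A, eval (bwPi P z) F = 0) → F = 0)
    {R : Type} [CommRing R] [IsDomain R]
    (mk : MvPolynomial (Fin N) ℂ →+* R) (hmk : Function.Surjective mk)
    (hker : ∀ p, mk p = 0 ↔ ∀ z ∈ A, eval z p = 0)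
    (hAI : ∀ z, (∀ p, mk p = 0 → eval z p = 0) → z ∈ A)
    [Algebra (MvPolynomial (Fin k) ℂ) R] [Algebra.IsIntegral (MvPolynomial (Fin k) ℂ) R]
    [Module.Finite (MvPolynomial (Fin k) ℂ) R]
    (halg : ∀ F, algebraMap (MvPolynomial (Fin k) ℂ) R F = mk (aeval P F)) : Nonempty (BWData A) := by
  have hevP : ∀ (F : MvPolynomial (Fin k) ℂ) z, eval z (aeval P F) = eval (bwPi P z) F := by
    intro F z
    have : (aeval z).comp (aeval P) = (aeval (bwPi P z) : MvPolynomial (Fin k) ℂ →ₐ[ℂ] ℂ) := by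
      apply MvPolynomial.algHom_ext; intro j; simp [bwPi, aeval_eq_eval]
    have := congrArg (fun g => g F) this
    simpa [aeval_eq_eval] using this
  have hφinj : Function.Injective (algebraMap (MvPolynomial (Fin k) ℂ) R) := by
    rw [injective_iff_map_eq_zero]
    intro F hF
    apply hinj
    intro z hz
    rw [halg, hker] at hF
    rw [← hevP]; exact hF z hz
  have inst4 : FaithfulSMul (MvPolynomial (Fin k) ℂ) R := (faithfulSMul_iff_algebraMap_injective _ R).2 hφinj
  have inst7 : Module.IsTorsionFree (MvPolynomial (Fin k) ℂ) R := inferInstance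
  have inst1 : Algebra.IsIntegral (MvPolynomial (Fin k) ℂ) R := inferInstance
  -- evaluation of R at points of A
  have hev : ∀ z ∈ A, ∃ e : R →+* ℂ, (∀ r, e (mk r) = eval z r) ∧
      ∀ (p : Polynomial (MvPolynomial (Fin k) ℂ)) (r : MvPolynomial (Fin N) ℂ),
        e (Polynomial.aeval (mk r) p) = bwEv p (bwPi P z) (eval z r) := by
    intro z hz
    have hle : RingHom.ker mk ≤ RingHom.ker (eval z) := fun p hp =>
      (hker p).1 hp z hz
    have he1 : ∀ r, (mk.liftOfSurjective hmk ⟨eval z, hle⟩) (mk r) = eval z r := fun r =>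
      RingHom.liftOfRightInverse_comp_apply mk _ _ ⟨eval z, hle⟩ r
    refine ⟨mk.liftOfSurjective hmk ⟨eval z, hle⟩, he1, ?_⟩
    intro p r
    rw [Polynomial.aeval_def, Polynomial.hom_eval₂, bwEv, he1]
    congr 1
    apply RingHom.ext
    intro F
    rw [RingHom.comp_apply, halg, he1, hevP]
  have hroot : ∀ r : MvPolynomial (Fin N) ℂ, ∀ z ∈ A,
      bwEv (minpoly (MvPolynomial (Fin k) ℂ) (mk r)) (bwPi P z) (eval z r) = 0 := by
    intro r z hz
    obtain ⟨e, -, he⟩ := hev z hz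
    rw [← he, minpoly.aeval, map_zero]
  have hsurj : ∀ r : MvPolynomial (Fin N) ℂ, ∀ x τ,
      bwEv (minpoly (MvPolynomial (Fin k) ℂ) (mk r)) x τ = 0 → ∃ z ∈ A, bwPi P z = x ∧ eval z r = τ := by
    intro r x τ h0
    let ψ : Polynomial (MvPolynomial (Fin k) ℂ) →+* R := (Polynomial.aeval (mk r)).toRingHom
    let ε : Polynomial (MvPolynomial (Fin k) ℂ) →+* ℂ := Polynomial.eval₂RingHom (eval x) τ
    have hψC : ∀ F, ψ (Polynomial.C F) = mk (aeval P F) := by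
      intro F; rw [← halg]; exact Polynomial.aeval_C _ _
    have hψX : ψ Polynomial.X = mk r := Polynomial.aeval_X _
    have hεC : ∀ F, ε (Polynomial.C F) = eval x F := fun F => Polynomial.eval₂_C _ _
    have hεX : ε Polynomial.X = τ := Polynomial.eval₂_X _ _
    have hψint : ψ.IsIntegral := by
      apply RingHom.IsIntegral.tower_top (Polynomial.C) ψ
      have : ψ.comp Polynomial.C = algebraMap (MvPolynomial (Fin k) ℂ) R :=
        RingHom.ext fun F => by rw [RingHom.comp_apply, hψC, halg]
      rw [this]
      exact inst1.1
    let _ : Algebra (Polynomial (MvPolynomial (Fin k) ℂ)) R := ψ.toAlgebra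
    have i1 : Algebra.IsIntegral (Polynomial (MvPolynomial (Fin k) ℂ)) R := ⟨hψint⟩
    have hεs : Function.Surjective ε := by
      intro c
      exact ⟨Polynomial.C (C c), by rw [hεC, eval_C]⟩
    have i2 : (RingHom.ker ε).IsMaximal := RingHom.ker_isMaximal_of_surjective ε hεs
    obtain ⟨Q, hQ, hQe⟩ := Ideal.exists_ideal_over_maximal_of_isIntegral (S := R) (RingHom.ker ε) (by
      have : RingHom.ker (algebraMap (Polynomial (MvPolynomial (Fin k) ℂ)) R) =
        Ideal.span {minpoly (MvPolynomial (Fin k) ℂ) (mk r)} := minpoly.ker_eval (inst1.1 _)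
      rw [this, Ideal.span_le, Set.singleton_subset_iff]
      exact h0)
    have i3 : (Q.comap mk).IsMaximal :=
      Ideal.comap_isMaximal_of_surjective _ hmk
    obtain ⟨z, hz⟩ := (isMaximal_iff_eq_vanishingIdeal_singleton).1 i3
    have hmem : ∀ p, mk p ∈ Q ↔ eval z p = 0 := by
      intro p
      rw [← Ideal.mem_comap, hz, mem_vanishingIdeal_singleton_iff, aeval_eq_eval]
    have hmem2 : ∀ p : Polynomial (MvPolynomial (Fin k) ℂ), ψ p ∈ Q ↔ ε p = 0 := by
      intro p
      rw [← RingHom.mem_ker, ← hQe]; rfl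
    refine ⟨z, hAI z fun p hp => ?_, ?_, ?_⟩
    · rw [← hmem, hp]; exact zero_mem _
    · funext j
      have h1 : ε (Polynomial.C (X j - C (x j))) = 0 := by rw [hεC]; simp
      rw [← hmem2, hψC, hmem] at h1
      simpa [sub_eq_zero, bwPi] using h1
    · have h1 : ε (Polynomial.X - Polynomial.C (C τ)) = 0 := by rw [map_sub, hεC, hεX]; simp
      rw [← hmem2, map_sub, hψC, hψX, ← map_sub, hmem] at h1
      simpa [sub_eq_zero] using h1
  obtain ⟨ℓ', ⟨D1, hD1, a, b, hab⟩, hg⟩ := bw_prim (S := MvPolynomial (Fin k) ℂ) (R := R)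
  obtain ⟨l, rfl⟩ := hmk ℓ'
  choose Di hDi gi hgi using fun i : Fin N => hg (mk (X i))
  refine ⟨{
    k := k
    P := P
    lower := hlow
    upper := hup
    inj := hinj
    s := (⊤ : Submodule (MvPolynomial (Fin k) ℂ) R).spanFinrank
    lift := fun r => ⟨minpoly (MvPolynomial (Fin k) ℂ) (mk r), minpoly.monic (inst1.1 _),
      minpoly.natDegree_le_spanFinrank (MvPolynomial (Fin k) ℂ) _, hroot r, hsurj r⟩
    l := l
    χ := minpoly (MvPolynomial (Fin k) ℂ) (mk l)
    monic := minpoly.monic (inst1.1 _)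
    root := hroot l
    surj := hsurj l
    D := D1 * ∏ i, Di i
    D0 := mul_ne_zero hD1 (Finset.prod_ne_zero_iff.2 fun i _ => hDi i)
    sep := ?_
    g := fun i => Polynomial.C (D1 * ∏ j ∈ Finset.univ.erase i, Di j) * gi i
    hg := ?_ }⟩
  · intro x τ hx h0 h1
    have h2 := congrArg (Polynomial.eval₂ (eval x) τ) hab
    rw [bwEv] at h0 h1
    rw [Polynomial.eval₂_add, Polynomial.eval₂_mul, Polynomial.eval₂_mul, h0, h1, Polynomial.eval₂_C] at h2
    apply hx
    rw [map_mul, ← h2]; simp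
  · intro z hz i
    obtain ⟨e, he1, he2⟩ := hev z hz
    have h1 := congrArg e (hgi i)
    rw [he2, map_mul, he1, eval_X] at h1
    have h3 : e (algebraMap (MvPolynomial (Fin k) ℂ) R (Di i)) = eval (bwPi P z) (Di i) := by
      rw [← hevP, ← he1, halg]
    rw [h3] at h1
    rw [bwEv] at h1 ⊢
    rw [Polynomial.eval₂_mul, Polynomial.eval₂_C, ← h1, ← Finset.mul_prod_erase Finset.univ Di (Finset.mem_univ i)]
    simp only [map_mul]; ring

theorem bwData_exists {N : ℕ} (A : Set (Fin N → ℂ)) (hA : A.Nonempty)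
    (I : Ideal (MvPolynomial (Fin N) ℂ)) (hI : ∀ p, p ∈ I ↔ ∀ z ∈ A, eval z p = 0)
    (hprime : I.IsPrime) (hAI : ∀ z, (∀ p ∈ I, eval z p = 0) → z ∈ A) : Nonempty (BWData A) := by
  obtain ⟨k, P, hlow, hup, hintg, hinj⟩ := bwNN_exists A hA I hI
  set φ : MvPolynomial (Fin k) ℂ →ₐ[ℂ] (MvPolynomial (Fin N) ℂ ⧸ I) :=
    aeval (fun j => Ideal.Quotient.mk I (P j)) with hφ
  have hcomp : ∀ F, φ F = Ideal.Quotient.mk I (aeval P F) := by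
    intro F
    have : φ = (Ideal.Quotient.mkₐ ℂ I).comp (aeval P) := by
      apply MvPolynomial.algHom_ext; intro j; simp [φ]
    rw [this]; rfl
  have hfin : φ.toRingHom.Finite := by
    apply RingHom.IsIntegral.to_finite hintg
    apply RingHom.FiniteType.of_comp_finiteType (f := (C : ℂ →+* MvPolynomial (Fin k) ℂ))
    have : φ.toRingHom.comp C = (Ideal.Quotient.mk I).comp C := by
      apply RingHom.ext; intro c
      simp [hφ]
      rfl
    rw [this]
    apply RingHom.FiniteType.comp
    · exact RingHom.FiniteType.of_surjective _ Ideal.Quotient.mk_surjective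
    · rw [← MvPolynomial.algebraMap_eq]
      exact RingHom.finiteType_algebraMap.2 inferInstance
  let _ : Algebra (MvPolynomial (Fin k) ℂ) (MvPolynomial (Fin N) ℂ ⧸ I) := φ.toRingHom.toAlgebra
  have i1 : Algebra.IsIntegral (MvPolynomial (Fin k) ℂ) (MvPolynomial (Fin N) ℂ ⧸ I) := ⟨hintg⟩
  have i2 : @Module.Finite (MvPolynomial (Fin k) ℂ) (MvPolynomial (Fin N) ℂ ⧸ I) _ _
    (φ.toRingHom.toAlgebra).toModule := hfin
  have i3 : IsDomain (MvPolynomial (Fin N) ℂ ⧸ I) := Ideal.Quotient.isDomain I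
  refine bwData_of A P hlow hup hinj (Ideal.Quotient.mk I) Ideal.Quotient.mk_surjective ?_ ?_ ?_
  · intro p; rw [Ideal.Quotient.eq_zero_iff_mem, hI]
  · intro z hz; exact hAI z fun p hp => hz p (Ideal.Quotient.eq_zero_iff_mem.2 hp)
  · intro F; exact hcomp F

theorem bw_root_bound (p : Polynomial ℂ) (hp : p.Monic) (s : ℕ) (hs : p.natDegree ≤ s) (K β : ℝ)
    (hK : 1 ≤ K) (hβ : 0 ≤ β) (hc : ∀ i < p.natDegree, ‖p.coeff i‖ ≤ K * β ^ (p.natDegree - i))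
    (T : ℂ) (hT : p.eval T = 0) : ‖T‖ ≤ (s * K + 1) * β := by
  by_contra hcon
  push Not at hcon
  have hs0 : (0 : ℝ) ≤ s := by positivity
  have hβT : β ≤ ‖T‖ := by
    have : 0 ≤ s * K * β := by positivity
    nlinarith
  have hT0 : 0 < ‖T‖ := lt_of_le_of_lt (by positivity) hcon
  set n := p.natDegree with hn
  rw [Polynomial.eval_eq_sum_range, Finset.sum_range_succ, ← hn] at hT
  have hlead : p.coeff n = 1 := hp
  rw [hlead, one_mul] at hT
  have h1 : ‖T‖ ^ n ≤ ∑ i ∈ Finset.range n, K * β ^ (n - i) * ‖T‖ ^ i := by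
    rw [← norm_pow, eq_neg_of_add_eq_zero_right hT, norm_neg]
    refine (norm_sum_le _ _).trans (Finset.sum_le_sum fun i hi => ?_)
    rw [norm_mul, norm_pow]
    gcongr
    exact hc i (Finset.mem_range.1 hi)
  rcases Nat.eq_zero_or_pos n with h0 | h0
  · rw [h0] at h1; simp at h1; linarith
  have h2 : ∑ i ∈ Finset.range n, K * β ^ (n - i) * ‖T‖ ^ i ≤
      ∑ i ∈ Finset.range n, K * β * ‖T‖ ^ (n - 1) := by
    refine Finset.sum_le_sum fun i hi => ?_
    have hi := Finset.mem_range.1 hi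
    have e1 : n - i = (n - i - 1) + 1 := by omega
    have e2 : n - 1 = (n - i - 1) + i := by omega
    rw [e1, e2, pow_succ, pow_add]
    have : β ^ (n - i - 1) ≤ ‖T‖ ^ (n - i - 1) := by gcongr
    calc _ = (K * β * ‖T‖ ^ i) * β ^ (n - i - 1) := by ring
      _ ≤ (K * β * ‖T‖ ^ i) * ‖T‖ ^ (n - i - 1) := by gcongr
      _ = _ := by ring
  rw [Finset.sum_const, Finset.card_range, nsmul_eq_mul] at h2
  have h3 : ‖T‖ * ‖T‖ ^ (n - 1) ≤ (n * K * β) * ‖T‖ ^ (n - 1) := by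
    rw [← pow_succ', Nat.sub_add_cancel h0]; linarith
  have h4 := le_of_mul_le_mul_right h3 (by positivity)
  have h5 : (n : ℝ) * K * β ≤ s * K * β := by gcongr
  nlinarith

theorem bwEv_eq {k : ℕ} (χ : Polynomial (MvPolynomial (Fin k) ℂ)) (x : Fin k → ℂ) (τ : ℂ) :
    bwEv χ x τ = (χ.map (eval x)).eval τ := by
  rw [bwEv, Polynomial.eval_map]

theorem bw_coeff {k : ℕ} (χ : Polynomial (MvPolynomial (Fin k) ℂ)) (hχ : χ.Monic) (x : Fin k → ℂ)
    (B : ℝ) (hB : 0 ≤ B) (h : ∀ τ, bwEv χ x τ = 0 → ‖τ‖ ≤ B) (i : ℕ) :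
    ‖eval x (χ.coeff i)‖ ≤ 2 ^ χ.natDegree * B ^ (χ.natDegree - i) := by
  have hm := hχ.map (eval x)
  have hd : (χ.map (eval x)).natDegree = χ.natDegree := hχ.natDegree_map _
  have h1 := Polynomial.coeff_le_of_roots_le (p := χ.map (eval x)) (f := RingHom.id ℂ) (B := B) i hm
    (IsAlgClosed.splits _) (by
      intro z hz
      rw [Polynomial.map_id] at hz
      apply h
      rw [bwEv_eq]
      exact (Polynomial.mem_roots'.1 hz).2)
  rw [Polynomial.map_id, hd, Polynomial.coeff_map] at h1
  refine h1.trans ?_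
  rw [mul_comm]
  gcongr
  exact_mod_cast Nat.choose_le_two_pow _ _

theorem bw_fibre {N : ℕ} {A : Set (Fin N → ℂ)} (d : BWData A) (x1 : Fin d.k → ℂ) (r : ℝ) (hr : 0 < r) :
    ∃ C : ℝ, 1 ≤ C ∧ ∀ m : ℕ, 1 ≤ m → ∀ q : MvPolynomial (Fin N) ℂ, q.totalDegree ≤ m →
      ∀ b : ℝ, 0 ≤ b → (∀ z ∈ A, ‖bwPi d.P z - x1‖ ≤ r → ‖eval z q‖ ≤ b) →
      ∀ z ∈ A, ‖eval z q‖ ≤ b * (C * (1 + ‖z‖)) ^ m := by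
  obtain ⟨Cl, hCl⟩ := d.lower
  obtain ⟨Cu, hCu⟩ := d.upper
  set C1 : ℝ := max 1 ((|Cu| + ‖x1‖) / r) with hC1
  set s := d.s
  have hC1' : 1 ≤ C1 := le_max_left _ _
  have hs0 : (0 : ℝ) ≤ s := by positivity
  have hsp : (1 : ℝ) ≤ s * 2 ^ s + 1 := by
    have : (0 : ℝ) ≤ s * 2 ^ s := by positivity
    linarith
  refine ⟨(s * 2 ^ s + 1) * (1 + s) * C1, ?_, ?_⟩
  · have h1 : (1 : ℝ) ≤ (1 + s) := by linarith
    exact one_le_mul_of_one_le_of_one_le (one_le_mul_of_one_le_of_one_le hsp h1) hC1'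
  intro m hm q hq b hb hqb z hz
  obtain ⟨χ, hχ, hχs, hχr, hχl⟩ := d.lift q
  obtain ⟨Cq, hCq0, hCq⟩ := bw_growth q m hq
  set n := χ.natDegree with hn
  set v := bwPi d.P z - x1 with hv
  have hglob : ∀ x τ, bwEv χ x τ = 0 → ‖τ‖ ≤ Cq * (|Cl| * (1 + ‖x‖)) ^ m := by
    intro x τ h
    obtain ⟨y, hy, hyx, rfl⟩ := hχl x τ h
    refine (hCq y).trans ?_
    gcongr
    have := hCl y hy
    rw [hyx] at this
    refine this.trans ?_
    gcongr
    exact le_abs_self _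
  have hloc : ∀ x τ, ‖x - x1‖ ≤ r → bwEv χ x τ = 0 → ‖τ‖ ≤ b := by
    intro x τ hx h
    obtain ⟨y, hy, hyx, rfl⟩ := hχl x τ h
    exact hqb y hy (by rw [hyx]; exact hx)
  set W := C1 * (1 + ‖z‖) with hW
  have hz0 := norm_nonneg z
  have hW1 : 1 ≤ W := one_le_mul_of_one_le_of_one_le hC1' (by linarith)
  have hvW : (‖v‖ + 1) / r ≤ W := by
    have h1 : ‖v‖ + 1 ≤ (|Cu| + ‖x1‖) * (1 + ‖z‖) := by
      have e1 := norm_sub_le (bwPi d.P z) x1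
      have e2 := hCu z
      have e3 : Cu * (1 + ‖z‖) ≤ |Cu| * (1 + ‖z‖) := by
        gcongr; exact le_abs_self _
      have e4 : 0 ≤ ‖x1‖ * ‖z‖ := by positivity
      nlinarith
    calc (‖v‖ + 1) / r ≤ ((|Cu| + ‖x1‖) * (1 + ‖z‖)) / r := by gcongr
      _ = ((|Cu| + ‖x1‖) / r) * (1 + ‖z‖) := by ring
      _ ≤ _ := by rw [hW]; gcongr; exact le_max_right _ _
  have hcoef : ∀ i < n, ‖eval (bwPi d.P z) (χ.coeff i)‖ ≤ (2 ^ s * (s * m + 1)) * (b * W ^ m) ^ (n - i) := by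
    intro i hi
    obtain ⟨p, hp⟩ := bw_line (χ.coeff i) x1 v
    have hdiff : Differentiable ℂ fun t : ℂ => eval (x1 + t • v) (χ.coeff i) := by
      simp_rw [← hp]; exact p.differentiable
    have hgr : ∀ t : ℂ, ‖eval (x1 + t • v) (χ.coeff i)‖ ≤
        (2 ^ n * (Cq * (|Cl| * (1 + ‖x1‖ + ‖v‖)) ^ m) ^ (n - i)) * (1 + ‖t‖) ^ (m * (n - i)) := by
      intro t
      refine (bw_coeff χ hχ _ _ (by positivity) (hglob _) i).trans ?_
      rw [mul_assoc, pow_mul, ← mul_pow, mul_assoc Cq, ← mul_pow, mul_assoc]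
      gcongr
      have e1 := norm_add_le x1 (t • v)
      rw [norm_smul] at e1
      have := norm_nonneg t
      have := norm_nonneg v
      have := norm_nonneg x1
      nlinarith [mul_nonneg (norm_nonneg t) (norm_nonneg x1)]
    have := bw_entire_bound _ hdiff _ _ hgr (2 ^ n * b ^ (n - i)) (r / (‖v‖ + 1)) (by positivity) (by
      intro t ht
      refine bw_coeff χ hχ _ _ hb (fun τ => hloc _ τ ?_) i
      rw [add_sub_cancel_left, norm_smul]
      rw [le_div_iff₀ (by positivity)] at ht
      nlinarith [norm_nonneg t])
    have e0 : x1 + (1 : ℂ) • v = bwPi d.P z := by rw [hv]; simp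
    rw [e0] at this
    refine this.trans ?_
    have e1 : max 1 (1 / (r / (‖v‖ + 1))) ≤ W := by
      rw [one_div_div]; exact max_le hW1 hvW
    have e2 : ((m * (n - i) : ℕ) : ℝ) ≤ s * m := by
      rw [mul_comm]
      exact_mod_cast Nat.mul_le_mul_right m ((Nat.sub_le n i).trans hχs)
    calc 2 ^ n * b ^ (n - i) * (((m * (n - i) : ℕ) : ℝ) + 1) * max 1 (1 / (r / (‖v‖ + 1))) ^ (m * (n - i))
        ≤ 2 ^ s * b ^ (n - i) * (s * m + 1) * W ^ (m * (n - i)) := by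
          gcongr
          norm_num
      _ = _ := by rw [pow_mul, mul_pow]; ring
  have hm0 : (0 : ℝ) ≤ m := by positivity
  have hK : (1 : ℝ) ≤ 2 ^ s * (s * m + 1) := by
    apply one_le_mul_of_one_le_of_one_le (one_le_pow₀ (by norm_num))
    have : (0 : ℝ) ≤ s * m := by positivity
    linarith
  have hmap : (χ.map (eval (bwPi d.P z))).natDegree = n := hχ.natDegree_map _
  have := bw_root_bound (χ.map (eval (bwPi d.P z))) (hχ.map _) s (by rw [hmap]; exact hχs)
    (2 ^ s * (s * m + 1)) (b * W ^ m) hK (by positivity) (by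
      intro i hi
      rw [hmap] at hi ⊢
      rw [Polynomial.coeff_map]
      exact hcoef i hi) (eval z q) (by rw [← bwEv_eq]; exact hχr z hz)
  refine this.trans ?_
  have b1 : (1 : ℝ) + m * s ≤ (1 + s) ^ m := one_add_mul_le_pow (by linarith) m
  have b2 : (s : ℝ) * 2 ^ s + 1 ≤ (s * 2 ^ s + 1) ^ m := le_self_pow₀ hsp (by omega)
  calc (s * (2 ^ s * (s * m + 1)) + 1) * (b * W ^ m)
      ≤ ((s * 2 ^ s + 1) * (1 + m * s)) * (b * W ^ m) := by
        gcongr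
        have : (0 : ℝ) ≤ m * s := by positivity
        nlinarith
    _ ≤ ((s * 2 ^ s + 1) ^ m * (1 + s) ^ m) * (b * W ^ m) := by gcongr
    _ = _ := by rw [hW]; simp only [mul_pow]; ring

theorem bw_small_root (p : Polynomial ℂ) (hp : p.Monic) (ε : ℝ) (hε : 0 < ε)
    (h : ‖p.eval 0‖ < ε ^ p.natDegree) : ∃ τ, p.eval τ = 0 ∧ ‖τ‖ < ε := by
  by_contra hcon
  push Not at hcon
  have hs : p.Splits := IsAlgClosed.splits p
  have h1 : p.eval 0 = (p.roots.map fun a => 0 - a).prod := by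
    conv_lhs => rw [hs.eq_prod_roots_of_monic hp]
    rw [Polynomial.eval_multiset_prod, Multiset.map_map]
    simp
  have h2 : ∀ M : Multiset ℂ, (∀ τ ∈ M, ε ≤ ‖τ‖) → ε ^ M.card ≤ ‖(M.map fun a => 0 - a).prod‖ := by
    intro M
    induction M using Multiset.induction_on with
    | empty => simp
    | cons a M ih =>
      intro hM
      rw [Multiset.map_cons, Multiset.prod_cons, Multiset.card_cons, norm_mul, pow_succ', zero_sub, norm_neg]
      have e1 := hM a (Multiset.mem_cons_self _ _)
      have e2 := ih fun τ hτ => hM τ (Multiset.mem_cons_of_mem hτ)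
      gcongr
  have h3 := h2 p.roots fun τ hτ => hcon τ (Polynomial.mem_roots'.1 hτ).2
  rw [← h1, ← hs.natDegree_eq_card_roots] at h3
  linarith

theorem bw_mv_continuous {k : ℕ} (F : MvPolynomial (Fin k) ℂ) : Continuous fun x => eval x F :=
  MvPolynomial.continuous_eval F

theorem bwPi_continuous {N k : ℕ} (P : Fin k → MvPolynomial (Fin N) ℂ) : Continuous (bwPi P) :=
  continuous_pi fun j => MvPolynomial.continuous_eval (P j)

theorem bwEv_sum {k : ℕ} (χ : Polynomial (MvPolynomial (Fin k) ℂ)) (x : Fin k → ℂ) (τ : ℂ) :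
    bwEv χ x τ = ∑ i ∈ Finset.range (χ.natDegree + 1), eval x (χ.coeff i) * τ ^ i := by
  rw [bwEv, Polynomial.eval₂_eq_sum_range]

theorem bwEv_continuous {k : ℕ} (χ : Polynomial (MvPolynomial (Fin k) ℂ)) :
    Continuous fun y : (Fin k → ℂ) × ℂ => bwEv χ y.1 y.2 := by
  simp_rw [bwEv_sum]
  refine continuous_finsetSum _ fun i _ => ?_
  exact ((bw_mv_continuous _).comp continuous_fst).mul (continuous_snd.pow i)

theorem bw_D_dense {k : ℕ} (D : MvPolynomial (Fin k) ℂ) (hD : D ≠ 0) (x : Fin k → ℂ) (ε : ℝ) (hε : 0 < ε) :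
    ∃ y, ‖y - x‖ < ε ∧ eval y D ≠ 0 := by
  obtain ⟨y, hy⟩ : ∃ y, eval y D ≠ 0 := by
    by_contra hcon
    push Not at hcon
    exact hD (MvPolynomial.funext fun y => by rw [hcon, map_zero])
  obtain ⟨B, hB⟩ := bw_line_finite D y (x - y) hy
  have hc : ContinuousAt (fun t : ℂ => y + t • (x - y)) 1 := by fun_prop
  have hd : Dense ((B : Set ℂ)ᶜ) := Countable.dense_compl ℝ B.countable_toSet
  have h1 : {t : ℂ | ‖(y + t • (x - y)) - x‖ < ε} ∈ 𝓝 (1 : ℂ) := by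
    have h2 : ContinuousAt (fun t : ℂ => ‖(y + t • (x - y)) - x‖) 1 := by fun_prop
    apply h2.eventually_lt continuousAt_const
    simpa using hε
  obtain ⟨t, ht1, ht2⟩ := hd.inter_nhds_nonempty h1
  exact ⟨_, ht2, (hB t).1 (by simpa using ht1)⟩

theorem bw_fibre_finite {N : ℕ} {A : Set (Fin N → ℂ)} (d : BWData A) (x : Fin d.k → ℂ) :
    {z | z ∈ A ∧ bwPi d.P z = x}.Finite := by
  choose χ h1 h2 h3 h4 using fun i : Fin N => d.lift (X i)
  have : (Set.univ.pi fun i : Fin N => {τ : ℂ | ((χ i).map (eval x)).IsRoot τ}).Finite :=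
    Set.Finite.pi fun i => Polynomial.finite_setOfPred_isRoot ((h1 i).map (eval x)).ne_zero
  refine this.subset ?_
  rintro z ⟨hz, rfl⟩ i -
  have := h3 i z hz
  rw [bwEv_eq, eval_X] at this
  exact this

theorem bw_separate {N : ℕ} (F : Set (Fin N → ℂ)) (hF : F.Finite) (a : Fin N → ℂ) :
    ∃ L : MvPolynomial (Fin N) ℂ, eval a L = 0 ∧ ∀ b ∈ F, eval b L = 0 → b = a := by
  have hi : ∀ b : Fin N → ℂ, ∃ p : MvPolynomial (Fin N) ℂ, eval b p = 0 ∧ (b ≠ a → eval a p = 1) := by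
    intro b
    by_cases h : b = a
    · exact ⟨0, by simp, fun h' => absurd h h'⟩
    · obtain ⟨i, hi⟩ := Function.ne_iff.1 h
      refine ⟨C (a i - b i)⁻¹ * (X i - C (b i)), by simp, fun _ => ?_⟩
      simp only [map_mul, eval_C, map_sub, eval_X]
      exact inv_mul_cancel₀ (sub_ne_zero.2 (Ne.symm hi))
  choose p hp1 hp2 using hi
  classical
  refine ⟨1 - ∏ b ∈ hF.toFinset.erase a, p b, ?_, ?_⟩
  · rw [map_sub, map_one, map_prod, Finset.prod_eq_one, sub_self]
    intro b hb
    exact hp2 b (Finset.ne_of_mem_erase hb)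
  · intro b hb h0
    by_contra hba
    rw [map_sub, map_one, map_prod, Finset.prod_eq_zero (i := b)
      (Finset.mem_erase.2 ⟨hba, by simpa using hb⟩) (hp1 b)] at h0
    simp at h0

theorem bw_compact {N : ℕ} {A : Set (Fin N → ℂ)} (hA : IsClosed A) (d : BWData A) (x : Fin d.k → ℂ)
    (r : ℝ) : IsCompact {z | z ∈ A ∧ ‖bwPi d.P z - x‖ ≤ r} := by
  obtain ⟨Cl, hCl⟩ := d.lower
  apply Metric.isCompact_of_isClosed_isBounded
  · exact hA.inter (isClosed_le ((bwPi_continuous _).sub continuous_const).norm continuous_const)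
  · refine (Metric.isBounded_iff_subset_closedBall 0).2 ⟨|Cl| * (1 + (r + ‖x‖)), ?_⟩
    rintro z ⟨hz, hzr⟩
    rw [mem_closedBall_zero_iff]
    have h1 := hCl z hz
    have h2 : ‖bwPi d.P z‖ ≤ r + ‖x‖ := by
      have := norm_sub_norm_le (bwPi d.P z) x
      linarith
    have h3 : Cl * (1 + ‖bwPi d.P z‖) ≤ |Cl| * (1 + (r + ‖x‖)) := by
      gcongr
      exact le_abs_self _
    linarith

theorem bw_dense {N : ℕ} {A : Set (Fin N → ℂ)} (hA : IsClosed A) (d : BWData A) (a : Fin N → ℂ)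
    (ha : a ∈ A) (U : Set (Fin N → ℂ)) (hU : U ∈ 𝓝 a) : ∃ z ∈ A, z ∈ U ∧ eval (bwPi d.P z) d.D ≠ 0 := by
  obtain ⟨L, hL0, hL⟩ := bw_separate _ (bw_fibre_finite d (bwPi d.P a)) a
  obtain ⟨χ, h1, h2, h3, h4⟩ := d.lift L
  obtain ⟨V, hVU, hVo, haV⟩ := _root_.mem_nhds_iff.1 hU
  set T := {z | z ∈ A ∧ ‖bwPi d.P z - bwPi d.P a‖ ≤ 1} ∩ Vᶜ with hT
  have hTc : IsCompact T := (bw_compact hA d _ 1).inter_right hVo.isClosed_compl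
  have hpos : ∀ z ∈ T, 0 < ‖bwPi d.P z - bwPi d.P a‖ + ‖eval z L‖ := by
    rintro z ⟨⟨hz, -⟩, hzV⟩
    by_contra hcon
    have e1 := norm_nonneg (bwPi d.P z - bwPi d.P a)
    have e2 := norm_nonneg (eval z L)
    have e3 : ‖bwPi d.P z - bwPi d.P a‖ = 0 := by linarith
    have e4 : ‖eval z L‖ = 0 := by linarith
    rw [norm_eq_zero] at e3 e4
    have := hL z ⟨hz, sub_eq_zero.1 e3⟩ e4
    rw [this] at hzV
    exact hzV haV
  obtain ⟨ε, hε, hmin⟩ : ∃ ε > 0, ∀ z ∈ T, ε ≤ ‖bwPi d.P z - bwPi d.P a‖ + ‖eval z L‖ := by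
    rcases T.eq_empty_or_nonempty with h | h
    · exact ⟨1, one_pos, fun z hz => by rw [h] at hz; exact absurd hz (by simp)⟩
    · obtain ⟨w, hw, hwm⟩ := hTc.exists_isMinOn h (f := fun z => ‖bwPi d.P z - bwPi d.P a‖ + ‖eval z L‖)
        ((((bwPi_continuous _).sub continuous_const).norm.add (bw_mv_continuous L).norm).continuousOn)
      exact ⟨_, hpos w hw, fun z hz => hwm hz⟩
  have hc : ContinuousAt (fun x => ‖bwEv χ x 0‖) (bwPi d.P a) :=
    ((bwEv_continuous χ).comp (Continuous.prodMk_left (0 : ℂ))).norm.continuousAt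
  have hev : ∀ᶠ x in 𝓝 (bwPi d.P a), ‖bwEv χ x 0‖ < (ε / 2) ^ χ.natDegree := by
    apply hc.eventually_lt continuousAt_const
    have := h3 a ha
    rw [hL0] at this
    rw [this, norm_zero]
    positivity
  obtain ⟨η, hη, hηb⟩ := Metric.eventually_nhds_iff.1 hev
  obtain ⟨x, hx, hxD⟩ := bw_D_dense d.D d.D0 (bwPi d.P a) (min η (min 1 (ε / 2)))
    (lt_min hη (lt_min one_pos (by positivity)))
  have hx1 := hηb (y := x) (by rw [dist_eq_norm]; exact hx.trans_le (min_le_left _ _))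
  rw [bwEv_eq, ← h1.natDegree_map (eval x)] at hx1
  obtain ⟨τ, hτ, hτε⟩ := bw_small_root _ (h1.map _) _ (by positivity) hx1
  obtain ⟨z, hz, hzx, hzτ⟩ := h4 x τ (by rw [bwEv_eq]; exact hτ)
  refine ⟨z, hz, hVU ?_, by rw [hzx]; exact hxD⟩
  by_contra hzV
  have e1 : ‖x - bwPi d.P a‖ < 1 := hx.trans_le ((min_le_right _ _).trans (min_le_left _ _))
  have e2 : ‖x - bwPi d.P a‖ < ε / 2 := hx.trans_le ((min_le_right _ _).trans (min_le_right _ _))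
  have := hmin z ⟨⟨hz, by rw [hzx]; exact e1.le⟩, hzV⟩
  rw [hzx, hzτ] at this
  linarith

theorem bw_mv_analytic {k : ℕ} (F : MvPolynomial (Fin k) ℂ) (x : Fin k → ℂ) :
    AnalyticAt ℂ (fun x => eval x F) x :=
  AnalyticOnNhd.eval_mvPolynomial (𝕜 := ℂ) F x (Set.mem_univ x)

theorem bwEv_analytic {k : ℕ} (χ : Polynomial (MvPolynomial (Fin k) ℂ)) (y : (Fin k → ℂ) × ℂ) :
    AnalyticAt ℂ (fun y : (Fin k → ℂ) × ℂ => bwEv χ y.1 y.2) y := by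
  simp_rw [bwEv_sum]
  refine Finset.analyticAt_fun_sum _ fun i _ => ?_
  have h1 : AnalyticAt ℂ (fun y : (Fin k → ℂ) × ℂ => eval y.1 (χ.coeff i)) y :=
    AnalyticAt.comp' (g := fun x => eval x (χ.coeff i)) (bw_mv_analytic _ _) analyticAt_fst
  exact h1.mul (analyticAt_snd.pow i)

theorem bw_root_sheet {k : ℕ} (χ : Polynomial (MvPolynomial (Fin k) ℂ)) (x0 : Fin k → ℂ) (τ0 : ℂ)
    (h0 : bwEv χ x0 τ0 = 0) (h1 : bwEv χ.derivative x0 τ0 ≠ 0) :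
    ∃ ψ : (Fin k → ℂ) → ℂ, AnalyticAt ℂ ψ x0 ∧ ψ x0 = τ0 ∧ (∀ᶠ x in 𝓝 x0, bwEv χ x (ψ x) = 0) ∧
      ∀ᶠ v in 𝓝 (x0, τ0), bwEv χ v.1 v.2 = 0 → ψ v.1 = v.2 := by
  set f : (Fin k → ℂ) × ℂ → ℂ := fun y => bwEv χ y.1 y.2 with hf
  have han : AnalyticAt ℂ f (x0, τ0) := bwEv_analytic χ _
  have hcd : ContDiffAt ℂ ⊤ f (x0, τ0) := han.contDiffAt
  have hn : (⊤ : WithTop ℕ∞) ≠ 0 := by simp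
  have hd : HasDerivAt (fun t => f (x0, t)) (bwEv χ.derivative x0 τ0) τ0 := by
    simp only [hf, bwEv_eq, ← Polynomial.derivative_map]
    exact (χ.map (eval x0)).hasDerivAt τ0
  have hd2 : HasDerivAt (fun t => f (x0, t)) (fderiv ℂ f (x0, τ0) (0, 1)) τ0 := by
    have e1 : HasDerivAt (fun t : ℂ => (x0, t)) ((0 : Fin k → ℂ), (1 : ℂ)) τ0 :=
      (hasDerivAt_const τ0 x0).prodMk (hasDerivAt_id τ0)
    exact (han.differentiableAt.hasFDerivAt (x := (x0, τ0))).comp_hasDerivAt τ0 e1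
  have he := hd2.unique hd
  have hinv : (fderiv ℂ f (x0, τ0) ∘L .inr ℂ (Fin k → ℂ) ℂ).IsInvertible := by
    refine ⟨ContinuousLinearEquiv.unitsEquivAut ℂ (Units.mk0 _ h1), ?_⟩
    ext
    simp [he]
  refine ⟨hcd.implicitFunction hn hinv, ?_, hcd.implicitFunction_apply_self hn hinv, ?_, ?_⟩
  · exact (hcd.contDiffAt_implicitFunction hn hinv).analyticAt
  · have := hcd.eventually_apply_implicitFunction hn hinv
    filter_upwards [this] with x hx
    exact hx.trans h0
  · filter_upwards [hcd.eventually_apply_eq_iff_implicitFunction hn hinv] with v hv h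
    exact hv.1 (Eq.trans h h0.symm)

/-- reconstruction of a point from its projection and the value of the primitive element. -/
noncomputable def bwGam {N : ℕ} {A : Set (Fin N → ℂ)} (d : BWData A) (x : Fin d.k → ℂ) (τ : ℂ) :
    Fin N → ℂ := fun i => bwEv (d.g i) x τ / eval x d.D

theorem bwGam_eq {N : ℕ} {A : Set (Fin N → ℂ)} (d : BWData A) (z : Fin N → ℂ) (hz : z ∈ A)
    (hD : eval (bwPi d.P z) d.D ≠ 0) : bwGam d (bwPi d.P z) (eval z d.l) = z := by
  funext i
  rw [bwGam, ← d.hg z hz i, mul_div_cancel_left₀ _ hD]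

theorem bwGam_spec {N : ℕ} {A : Set (Fin N → ℂ)} (d : BWData A) (x : Fin d.k → ℂ) (τ : ℂ)
    (hD : eval x d.D ≠ 0) (h : bwEv d.χ x τ = 0) :
    bwGam d x τ ∈ A ∧ bwPi d.P (bwGam d x τ) = x ∧ eval (bwGam d x τ) d.l = τ := by
  obtain ⟨z, hz, rfl, rfl⟩ := d.surj x τ h
  rw [bwGam_eq d z hz hD]
  exact ⟨hz, rfl, rfl⟩

theorem bwGam_analytic {N : ℕ} {A : Set (Fin N → ℂ)} (d : BWData A) (x : Fin d.k → ℂ)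
    (ψ : (Fin d.k → ℂ) → ℂ) (hψ : AnalyticAt ℂ ψ x) (hD : eval x d.D ≠ 0) :
    AnalyticAt ℂ (fun x => bwGam d x (ψ x)) x := by
  rw [analyticAt_pi_iff]
  intro i
  refine AnalyticAt.div ?_ (bw_mv_analytic _ _) hD
  exact AnalyticAt.comp' (g := fun y : (Fin d.k → ℂ) × ℂ => bwEv (d.g i) y.1 y.2)
    (f := fun x => (x, ψ x)) (bwEv_analytic _ _) (analyticAt_id.prod hψ)

theorem bw_sheet {N : ℕ} {A : Set (Fin N → ℂ)} (d : BWData A) (a : Fin N → ℂ) (ha : a ∈ A)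
    (hD : eval (bwPi d.P a) d.D ≠ 0) : ∃ σ : (Fin d.k → ℂ) → (Fin N → ℂ),
      AnalyticAt ℂ σ (bwPi d.P a) ∧ σ (bwPi d.P a) = a ∧
      (∀ᶠ x in 𝓝 (bwPi d.P a), σ x ∈ A ∧ bwPi d.P (σ x) = x) ∧
      ∀ᶠ z in 𝓝 a, z ∈ A → σ (bwPi d.P z) = z := by
  have hr := d.root a ha
  obtain ⟨ψ, h1, h2, h3, h4⟩ := bw_root_sheet d.χ (bwPi d.P a) (eval a d.l) hr (d.sep _ _ hD hr)
  have hDe : ∀ᶠ x in 𝓝 (bwPi d.P a), eval x d.D ≠ 0 :=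
    (bw_mv_continuous d.D).continuousAt.eventually_ne hD
  refine ⟨fun x => bwGam d x (ψ x), bwGam_analytic d _ ψ h1 hD, ?_, ?_, ?_⟩
  · simp only [h2]; exact bwGam_eq d a ha hD
  · filter_upwards [h3, hDe] with x hx hxD
    exact ⟨(bwGam_spec d x _ hxD hx).1, (bwGam_spec d x _ hxD hx).2.1⟩
  · have hc : ContinuousAt (fun z => (bwPi d.P z, eval z d.l)) a :=
      ((bwPi_continuous d.P).prodMk (bw_mv_continuous d.l)).continuousAt
    filter_upwards [hc.eventually h4, (bwPi_continuous d.P).continuousAt.eventually hDe] with z hz hzD hzA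
    rw [hz (d.root z hzA), bwGam_eq d z hzA hzD]

/-- the set of roots of the defining polynomial over `x`. -/
noncomputable def bwRho {N : ℕ} {A : Set (Fin N → ℂ)} (d : BWData A) (x : Fin d.k → ℂ) : Finset ℂ :=
  (d.χ.map (eval x)).roots.toFinset

theorem bwRho_mem {N : ℕ} {A : Set (Fin N → ℂ)} (d : BWData A) (x : Fin d.k → ℂ) (τ : ℂ) :
    τ ∈ bwRho d x ↔ bwEv d.χ x τ = 0 := by
  rw [bwRho, Multiset.mem_toFinset, Polynomial.mem_roots (d.monic.map _).ne_zero, bwEv_eq]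
  rfl

theorem bwRho_card {N : ℕ} {A : Set (Fin N → ℂ)} (d : BWData A) (x : Fin d.k → ℂ)
    (hD : eval x d.D ≠ 0) : (bwRho d x).card = d.χ.natDegree := by
  have hs : (d.χ.map (eval x)).Splits := IsAlgClosed.splits _
  rw [← d.monic.natDegree_map (eval x), hs.natDegree_eq_card_roots, bwRho]
  apply Multiset.toFinset_card_of_nodup
  apply Polynomial.nodup_roots
  rw [Polynomial.separable_def, Polynomial.isCoprime_iff_aeval_ne_zero_of_isAlgClosed ℂ ℂ]
  intro τ
  by_cases h : bwEv d.χ x τ = 0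
  · right
    have := d.sep x τ hD h
    rw [bwEv_eq, ← Polynomial.derivative_map] at this
    simpa using this
  · left
    rw [bwEv_eq] at h
    simpa using h

theorem bwRho_local {N : ℕ} {A : Set (Fin N → ℂ)} (d : BWData A) (x0 : Fin d.k → ℂ)
    (hD : eval x0 d.D ≠ 0) : ∃ ψ : ℂ → (Fin d.k → ℂ) → ℂ,
      (∀ τ ∈ bwRho d x0, AnalyticAt ℂ (ψ τ) x0 ∧ ψ τ x0 = τ) ∧
      ∀ᶠ x in 𝓝 x0, Set.InjOn (fun τ => ψ τ x) (bwRho d x0 : Set ℂ) ∧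
        bwRho d x = (bwRho d x0).image (fun τ => ψ τ x) := by
  have h : ∀ τ : ℂ, ∃ ψ : (Fin d.k → ℂ) → ℂ, τ ∈ bwRho d x0 →
      (AnalyticAt ℂ ψ x0 ∧ ψ x0 = τ ∧ ∀ᶠ x in 𝓝 x0, bwEv d.χ x (ψ x) = 0) := by
    intro τ
    by_cases hτ : τ ∈ bwRho d x0
    · have h0 := (bwRho_mem d x0 τ).1 hτ
      obtain ⟨ψ, h1, h2, h3, -⟩ := bw_root_sheet d.χ x0 τ h0 (d.sep _ _ hD h0)
      exact ⟨ψ, fun _ => ⟨h1, h2, h3⟩⟩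
    · exact ⟨0, fun h => absurd h hτ⟩
  choose ψ hψ using h
  refine ⟨ψ, fun τ hτ => ⟨(hψ τ hτ).1, (hψ τ hτ).2.1⟩, ?_⟩
  have e1 : ∀ᶠ x in 𝓝 x0, ∀ τ ∈ bwRho d x0, bwEv d.χ x (ψ τ x) = 0 :=
    (Filter.eventually_all_finset _).2 fun τ hτ => (hψ τ hτ).2.2
  have e2 : ∀ᶠ x in 𝓝 x0, ∀ τ ∈ bwRho d x0, ∀ τ' ∈ bwRho d x0, τ ≠ τ' → ψ τ x ≠ ψ τ' x := by
    refine (Filter.eventually_all_finset _).2 fun τ hτ => (Filter.eventually_all_finset _).2 fun τ' hτ' => ?_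
    by_cases hne : τ = τ'
    · exact Filter.Eventually.of_forall fun x h => absurd hne h
    · have := ((hψ τ hτ).1.continuousAt.sub (hψ τ' hτ').1.continuousAt).eventually_ne
        (y := (0 : ℂ)) (by
          show ψ τ x0 - ψ τ' x0 ≠ 0
          rw [(hψ τ hτ).2.1, (hψ τ' hτ').2.1]; exact sub_ne_zero.2 hne)
      filter_upwards [this] with x hx _
      exact sub_ne_zero.1 hx
  have hDe : ∀ᶠ x in 𝓝 x0, eval x d.D ≠ 0 :=
    (bw_mv_continuous d.D).continuousAt.eventually_ne hD
  filter_upwards [e1, e2, hDe] with x hx1 hx2 hxD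
  have hinj : Set.InjOn (fun τ => ψ τ x) (bwRho d x0 : Set ℂ) := by
    intro τ hτ τ' hτ' h
    by_contra hne
    exact hx2 τ hτ τ' hτ' hne h
  refine ⟨hinj, (Finset.eq_of_subset_of_card_le ?_ ?_).symm⟩
  · intro t ht
    obtain ⟨τ, hτ, rfl⟩ := Finset.mem_image.1 ht
    exact (bwRho_mem d x _).2 (hx1 τ hτ)
  · rw [Finset.card_image_of_injOn hinj, bwRho_card d x hxD, bwRho_card d x0 hD]

open Classical in
/-- partial interpolation polynomial attached to a set `Ω`. -/
noncomputable def bwQ {N : ℕ} {A : Set (Fin N → ℂ)} (d : BWData A) (Ω : Set (Fin N → ℂ))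
    (x : Fin d.k → ℂ) : Polynomial ℂ :=
  ∑ τ ∈ bwRho d x, if bwGam d x τ ∈ Ω then
    ∏ τ' ∈ (bwRho d x).erase τ, (Polynomial.X - Polynomial.C τ') else 0

open Classical in
theorem bwQ_eval {N : ℕ} {A : Set (Fin N → ℂ)} (d : BWData A) (Ω : Set (Fin N → ℂ))
    (x : Fin d.k → ℂ) (T : ℂ) : (bwQ d Ω x).eval T =
    ∑ τ ∈ bwRho d x, if bwGam d x τ ∈ Ω then ∏ τ' ∈ (bwRho d x).erase τ, (T - τ') else 0 := by
  rw [bwQ, Polynomial.eval_finsetSum]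
  refine Finset.sum_congr rfl fun τ _ => ?_
  split_ifs
  · simp [Polynomial.eval_prod]
  · simp

open Classical in
theorem bwQ_eval_root {N : ℕ} {A : Set (Fin N → ℂ)} (d : BWData A) (Ω : Set (Fin N → ℂ))
    (x : Fin d.k → ℂ) (T : ℂ) (hT : T ∈ bwRho d x) : (bwQ d Ω x).eval T =
    if bwGam d x T ∈ Ω then ∏ τ' ∈ (bwRho d x).erase T, (T - τ') else 0 := by
  rw [bwQ_eval]
  refine Finset.sum_eq_single_of_mem T hT fun τ hτ hne => ?_
  split_ifs
  · exact Finset.prod_eq_zero (Finset.mem_erase.2 ⟨hne.symm, hT⟩) (sub_self T)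
  · rfl

theorem bwQ_degree {N : ℕ} {A : Set (Fin N → ℂ)} (d : BWData A) (Ω : Set (Fin N → ℂ))
    (x : Fin d.k → ℂ) (hD : eval x d.D ≠ 0) : (bwQ d Ω x).degree < d.χ.natDegree := by
  rw [bwQ, ← bwRho_card d x hD]
  refine (Polynomial.degree_sum_le _ _).trans_lt ?_
  rw [Finset.sup_lt_iff (by exact WithBot.bot_lt_coe _)]
  intro τ hτ
  split_ifs
  · rw [Polynomial.degree_prod]
    simp only [Polynomial.degree_X_sub_C, Finset.sum_const, Finset.card_erase_of_mem hτ]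
    have : 0 < (bwRho d x).card := Finset.card_pos.2 ⟨τ, hτ⟩
    rw [nsmul_one]
    norm_cast
    omega
  · rw [Polynomial.degree_zero]; exact WithBot.bot_lt_coe _

theorem bwQ_analytic {N : ℕ} {A : Set (Fin N → ℂ)} (d : BWData A) (Ω : Set (Fin N → ℂ))
    (hΩ : ∀ a ∈ A, eval (bwPi d.P a) d.D ≠ 0 → ∀ᶠ z in 𝓝 a, z ∈ A → (z ∈ Ω ↔ a ∈ Ω))
    (x0 : Fin d.k → ℂ) (hD : eval x0 d.D ≠ 0) (T : ℂ) :
    AnalyticAt ℂ (fun x => (bwQ d Ω x).eval T) x0 := by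
  classical
  obtain ⟨ψ, h1, h2⟩ := bwRho_local d x0 hD
  have hDe : ∀ᶠ x in 𝓝 x0, eval x d.D ≠ 0 :=
    (bw_mv_continuous d.D).continuousAt.eventually_ne hD
  have hmem : ∀ᶠ x in 𝓝 x0, ∀ τ ∈ bwRho d x0,
      bwGam d x (ψ τ x) ∈ A → (bwGam d x (ψ τ x) ∈ Ω ↔ bwGam d x0 τ ∈ Ω) := by
    refine (Filter.eventually_all_finset _).2 fun τ hτ => ?_
    have hs := bwGam_spec d x0 τ hD ((bwRho_mem d x0 τ).1 hτ)
    have hc := (bwGam_analytic d x0 (ψ τ) (h1 τ hτ).1 hD).continuousAt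
    have := hΩ _ hs.1 (by rw [hs.2.1]; exact hD)
    rw [ContinuousAt, (h1 τ hτ).2] at hc
    exact hc.eventually this
  have heq : (fun x => (bwQ d Ω x).eval T) =ᶠ[𝓝 x0] fun x => ∑ τ ∈ bwRho d x0,
      if bwGam d x0 τ ∈ Ω then ∏ τ' ∈ (bwRho d x0).erase τ, (T - ψ τ' x) else 0 := by
    filter_upwards [h2, hmem, hDe] with x hx hxm hxD
    rw [bwQ_eval, hx.2, Finset.sum_image hx.1]
    refine Finset.sum_congr rfl fun τ hτ => ?_
    have hτx : ψ τ x ∈ bwRho d x := by rw [hx.2]; exact Finset.mem_image_of_mem _ hτ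
    have hA := (bwGam_spec d x _ hxD ((bwRho_mem d x _).1 hτx)).1
    have e1 : ((bwRho d x0).image fun τ => ψ τ x).erase (ψ τ x) =
        ((bwRho d x0).erase τ).image fun τ => ψ τ x := by
      ext t
      simp only [Finset.mem_erase, Finset.mem_image]
      constructor
      · rintro ⟨hne, τ', hτ', rfl⟩
        exact ⟨τ', ⟨fun h => hne (by rw [h]), hτ'⟩, rfl⟩
      · rintro ⟨τ', ⟨hne, hτ'⟩, rfl⟩
        exact ⟨fun h => hne (hx.1 hτ' hτ h), τ', hτ', rfl⟩
    rw [e1, Finset.prod_image (hx.1.mono (by simp))]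
    simp only [hxm τ hτ hA]
  rw [analyticAt_congr heq]
  refine Finset.analyticAt_fun_sum _ fun τ hτ => ?_
  split_ifs
  · refine Finset.analyticAt_fun_prod _ fun τ' hτ' => ?_
    exact analyticAt_const.sub (h1 τ' (Finset.mem_of_mem_erase hτ')).1
  · exact analyticAt_const

theorem bwQ_growth {N : ℕ} {A : Set (Fin N → ℂ)} (d : BWData A) (Ω : Set (Fin N → ℂ)) (T : ℂ) :
    ∃ C : ℝ, ∃ e : ℕ, ∀ x, eval x d.D ≠ 0 → ‖(bwQ d Ω x).eval T‖ ≤ C * (1 + ‖x‖) ^ e := by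
  classical
  obtain ⟨Cl, hCl⟩ := d.lower
  obtain ⟨Cq, hCq0, hCq⟩ := bw_growth d.l d.l.totalDegree le_rfl
  set e := d.l.totalDegree
  set n := d.χ.natDegree
  set B := ‖T‖ + Cq * |Cl| ^ e with hB
  refine ⟨n * B ^ (n - 1), e * (n - 1), fun x hx => ?_⟩
  have hroot : ∀ τ ∈ bwRho d x, ‖T - τ‖ ≤ B * (1 + ‖x‖) ^ e := by
    intro τ hτ
    obtain ⟨z, hz, hzx, rfl⟩ := d.surj x τ ((bwRho_mem d x τ).1 hτ)
    have e1 : ‖eval z d.l‖ ≤ Cq * |Cl| ^ e * (1 + ‖x‖) ^ e := by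
      refine (hCq z).trans ?_
      rw [mul_assoc, ← mul_pow]
      gcongr
      have := hCl z hz
      rw [hzx] at this
      refine this.trans ?_
      gcongr
      exact le_abs_self _
    have e2 : (1 : ℝ) ≤ (1 + ‖x‖) ^ e := one_le_pow₀ (by linarith [norm_nonneg x])
    have e3 := norm_sub_le T (eval z d.l)
    have e4 : ‖T‖ ≤ ‖T‖ * (1 + ‖x‖) ^ e := le_mul_of_one_le_right (norm_nonneg _) e2
    rw [hB, add_mul]
    linarith
  rw [bwQ_eval]
  refine (norm_sum_le _ _).trans ?_
  have : ∀ τ ∈ bwRho d x, ‖if bwGam d x τ ∈ Ω then ∏ τ' ∈ (bwRho d x).erase τ, (T - τ') else 0‖ ≤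
      (B * (1 + ‖x‖) ^ e) ^ (n - 1) := by
    intro τ hτ
    split_ifs
    · rw [norm_prod]
      refine (Finset.prod_le_prod (fun _ _ => norm_nonneg _)
        fun τ' hτ' => hroot τ' (Finset.mem_of_mem_erase hτ')).trans ?_
      rw [Finset.prod_const, Finset.card_erase_of_mem hτ, bwRho_card d x hx]
    · rw [norm_zero]; positivity
  refine (Finset.sum_le_sum this).trans ?_
  rw [Finset.sum_const, bwRho_card d x hx, nsmul_eq_mul, mul_pow, pow_mul, mul_assoc]

theorem bw_indicator {N : ℕ} {A : Set (Fin N → ℂ)} (d : BWData A) (Ω : Set (Fin N → ℂ))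
    (hΩ : ∀ a ∈ A, eval (bwPi d.P a) d.D ≠ 0 → ∀ᶠ z in 𝓝 a, z ∈ A → (z ∈ Ω ↔ a ∈ Ω)) :
    ∃ p : MvPolynomial (Fin N) ℂ, ∀ z ∈ A, eval (bwPi d.P z) d.D ≠ 0 → (eval z p ≠ 0 ↔ z ∈ Ω) := by
  classical
  have hH : ∀ T : ℂ, ∃ H : MvPolynomial (Fin d.k) ℂ, ∀ x, eval x d.D ≠ 0 →
      eval x H = (bwQ d Ω x).eval T := by
    intro T
    obtain ⟨C, e, hC⟩ := bwQ_growth d Ω T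
    exact bw_liouville_mv _ d.D d.D0 (fun x hx => bwQ_analytic d Ω hΩ x hx T) C e hC
  choose H hH using hH
  set n := d.χ.natDegree
  let s : Finset ℕ := Finset.range n
  let v : ℕ → ℂ := fun i => (i : ℂ)
  have hv : Set.InjOn v (s : Set ℕ) := fun i _ j _ h => by simpa [v] using h
  refine ⟨∑ i ∈ s, aeval d.P (H (v i)) * Polynomial.aeval d.l (Lagrange.basis s v i), ?_⟩
  intro z hz hD
  have hevP : ∀ (F : MvPolynomial (Fin d.k) ℂ), eval z (aeval d.P F) = eval (bwPi d.P z) F := by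
    intro F
    have : (aeval z).comp (aeval d.P) = (aeval (bwPi d.P z) : MvPolynomial (Fin d.k) ℂ →ₐ[ℂ] ℂ) := by
      apply MvPolynomial.algHom_ext; intro j; simp [bwPi, aeval_eq_eval]
    have := congrArg (fun g => g F) this
    simpa [aeval_eq_eval] using this
  have hevL : ∀ q : Polynomial ℂ, eval z (Polynomial.aeval d.l q) = q.eval (eval z d.l) := by
    intro q
    rw [Polynomial.aeval_def, Polynomial.hom_eval₂, Polynomial.eval]
    congr 1
    ext c <;> simp
  have hroot : eval z d.l ∈ bwRho d (bwPi d.P z) := (bwRho_mem d _ _).2 (d.root z hz)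
  have hkey : eval z (∑ i ∈ s, aeval d.P (H (v i)) * Polynomial.aeval d.l (Lagrange.basis s v i)) =
      (bwQ d Ω (bwPi d.P z)).eval (eval z d.l) := by
    conv_rhs => rw [Lagrange.eq_interpolate (s := s) (f := bwQ d Ω (bwPi d.P z)) hv
      (by simpa [s] using bwQ_degree d Ω _ hD)]
    rw [Lagrange.interpolate_apply, Polynomial.eval_finsetSum, map_sum]
    refine Finset.sum_congr rfl fun i _ => ?_
    rw [map_mul, hevP, hevL, hH _ _ hD, Polynomial.eval_mul, Polynomial.eval_C]
  rw [hkey, bwQ_eval_root d Ω _ _ hroot, bwGam_eq d z hz hD]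
  split_ifs with h
  · simp only [h, iff_true]
    rw [Finset.prod_ne_zero_iff]
    intro τ' hτ'
    exact sub_ne_zero.2 (Finset.ne_of_mem_erase hτ').symm
  · simp [h]

theorem bw_connected {N : ℕ} {A : Set (Fin N → ℂ)} (d : BWData A)
    (hpr : ∀ p q : MvPolynomial (Fin N) ℂ, (∀ z ∈ A, eval z p * eval z q = 0) →
      (∀ z ∈ A, eval z p = 0) ∨ (∀ z ∈ A, eval z q = 0)) (Ω : Set (Fin N → ℂ))
    (hΩ : ∀ a ∈ A, eval (bwPi d.P a) d.D ≠ 0 → ∀ᶠ z in 𝓝 a, z ∈ A → (z ∈ Ω ↔ a ∈ Ω))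
    (a : Fin N → ℂ) (ha : a ∈ A) (haD : eval (bwPi d.P a) d.D ≠ 0) (haΩ : a ∈ Ω) :
    ∀ z ∈ A, eval (bwPi d.P z) d.D ≠ 0 → z ∈ Ω := by
  obtain ⟨p, hp⟩ := bw_indicator d Ω hΩ
  obtain ⟨q, hq⟩ := bw_indicator d Ωᶜ (fun a ha haD => by
    filter_upwards [hΩ a ha haD] with z hz hzA
    simp only [Set.mem_compl_iff, hz hzA])
  have hevP : ∀ z, ∀ (F : MvPolynomial (Fin d.k) ℂ), eval z (aeval d.P F) = eval (bwPi d.P z) F := by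
    intro z F
    have : (aeval z).comp (aeval d.P) = (aeval (bwPi d.P z) : MvPolynomial (Fin d.k) ℂ →ₐ[ℂ] ℂ) := by
      apply MvPolynomial.algHom_ext; intro j; simp [bwPi, aeval_eq_eval]
    have := congrArg (fun g => g F) this
    simpa [aeval_eq_eval] using this
  have h0 : ∀ z ∈ A, eval z (p * q) * eval z (aeval d.P d.D) = 0 := by
    intro z hz
    rw [hevP]
    by_cases hD : eval (bwPi d.P z) d.D = 0
    · rw [hD, mul_zero]
    · have h1 := hp z hz hD
      have h2 := hq z hz hD
      rw [map_mul]
      by_cases hzΩ : z ∈ Ω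
      · have : eval z q = 0 := by
          by_contra h
          exact (h2.1 h) hzΩ
        rw [this]; simp
      · have : eval z p = 0 := by
          by_contra h
          exact hzΩ (h1.1 h)
        rw [this]; simp
  rcases hpr _ _ h0 with h1 | h1
  · rcases hpr p q (fun z hz => by rw [← map_mul]; exact h1 z hz) with h2 | h2
    · exact absurd (h2 a ha) ((hp a ha haD).2 haΩ)
    · intro z hz hD
      by_contra hzΩ
      exact (hq z hz hD).2 hzΩ (h2 z hz)
  · exact absurd (by rw [← hevP]; exact h1 a ha) haD

theorem bw_num (S T c B : ℝ) (m : ℕ) (hT : 1 ≤ T) (hc : 0 < c) (hS : T ^ m ≤ S) (hB0 : 0 ≤ B)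
    (hB : B ≤ T ^ c) : B ^ m ≤ S ^ c := by
  calc B ^ m ≤ (T ^ c) ^ m := by gcongr
    _ = (T ^ m) ^ c := by
      rw [← Real.rpow_natCast, ← Real.rpow_natCast, ← Real.rpow_mul (by linarith),
        ← Real.rpow_mul (by linarith), mul_comm]
    _ ≤ S ^ c := by gcongr

theorem bw_large (c B : ℝ) (hc : 0 < c) : ∃ n0 : ℕ, ∀ n ≥ n0, B < ((n : ℝ) + 1) ^ c := by
  have h : Tendsto (fun n : ℕ => ((n : ℝ) + 1) ^ c) atTop atTop :=
    (tendsto_rpow_atTop hc).comp (tendsto_atTop_add_const_right _ _ tendsto_natCast_atTop_atTop)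
  exact eventually_atTop.1 (h.eventually (eventually_gt_atTop B))

/-- points near which the sequence `q` is exponentially small relative to `S`. -/
def bwOm {N : ℕ} (A : Set (Fin N → ℂ)) (q : ℕ → MvPolynomial (Fin N) ℂ) (S : ℕ → ℝ) :
    Set (Fin N → ℂ) :=
  {z | ∃ c : ℝ, 0 < c ∧ ∃ n0 : ℕ, ∀ᶠ z' in 𝓝 z, z' ∈ A → ∀ n ≥ n0, ‖eval z' (q n)‖ ≤ S n ^ (1 - c)}

theorem bwOm_local {N : ℕ} {A : Set (Fin N → ℂ)} (d : BWData A)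
    (q : ℕ → MvPolynomial (Fin N) ℂ) (S : ℕ → ℝ) (m : ℕ → ℕ) (hm : ∀ n, 1 ≤ m n)
    (hS : ∀ n : ℕ, ((n : ℝ) + 1) ^ m n ≤ S n)
    (hq : ∀ n, ∀ z ∈ A, ‖eval z (q n)‖ ≤ S n * (1 + ‖z‖) ^ m n)
    (a : Fin N → ℂ) (ha : a ∈ A) (haD : eval (bwPi d.P a) d.D ≠ 0) :
    ∃ V ∈ 𝓝 a, ∀ z1 ∈ V, ∀ z2 ∈ V, z1 ∈ A → z1 ∈ bwOm A q S → z2 ∈ bwOm A q S := by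
  obtain ⟨σ, h1, h2, h3, h4⟩ := bw_sheet d a ha haD
  set x0 := bwPi d.P a with hx0
  have hbd : ∀ᶠ x in 𝓝 x0, ‖σ x‖ < ‖a‖ + 1 := by
    have : ContinuousAt (fun x => ‖σ x‖) x0 := h1.continuousAt.norm
    refine this.eventually_lt continuousAt_const ?_
    rw [h2]; linarith
  obtain ⟨R, hR0, hR⟩ := Metric.eventually_nhds_iff_ball.1
    (h1.eventually_analyticAt.and (h3.and hbd))
  set r := R / 4 with hr
  have hr0 : 0 < r := by positivity
  have hπ : ∀ᶠ z in 𝓝 a, bwPi d.P z ∈ ball x0 r :=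
    (bwPi_continuous d.P).continuousAt.eventually (ball_mem_nhds _ hr0)
  obtain ⟨V, hV, hVo, haV⟩ := _root_.eventually_nhds_iff.1 (h4.and hπ)
  refine ⟨V, hVo.mem_nhds haV, ?_⟩
  rintro z1 hz1 z2 hz2 hz1A ⟨c, hc, n0, hcn⟩
  set x1 := bwPi d.P z1 with hx1
  have hσ1 : σ x1 = z1 := (hV z1 hz1).1 hz1A
  have hx1r : x1 ∈ ball x0 r := (hV z1 hz1).2
  have hx1R : x1 ∈ ball x0 R := ball_subset_ball (by linarith) hx1r
  have hcont : ContinuousAt σ x1 := (hR x1 hx1R).1.continuousAt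
  have hev : ∀ᶠ x in 𝓝 x1, σ x ∈ A → ∀ n ≥ n0, ‖eval (σ x) (q n)‖ ≤ S n ^ (1 - c) := by
    rw [ContinuousAt, hσ1] at hcont
    exact hcont.eventually hcn
  obtain ⟨η, hη0, hη⟩ := Metric.eventually_nhds_iff_ball.1 hev
  set ρ := min (1 / 2) (η / (4 * r)) with hρ
  have hρ0 : 0 < ρ := by positivity
  have hρ1 : ρ < 1 := (min_le_left _ _).trans_lt (by norm_num)
  have hρη : ρ * (2 * r) < η := by
    have : ρ * (4 * r) ≤ η := by
      calc ρ * (4 * r) ≤ η / (4 * r) * (4 * r) := by gcongr; exact min_le_right _ _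
        _ = η := by field_simp
    nlinarith
  obtain ⟨θ, hθ0, hθ1, K, hK, h3c⟩ := bw_three_circles ρ hρ0 hρ1
  set B := ‖a‖ + 2 with hB
  have hB1 : 1 ≤ B := by have := norm_nonneg a; linarith
  obtain ⟨n1, hn1⟩ := bw_large (θ * c / 2) (K * B) (by positivity)
  refine ⟨θ * c / 2, by positivity, max n0 n1, ?_⟩
  filter_upwards [hVo.mem_nhds hz2] with z hzV hzA n hn
  have hn0 : n0 ≤ n := (le_max_left _ _).trans hn
  have hn1 := hn1 n ((le_max_right _ _).trans hn)
  set x := bwPi d.P z with hx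
  have hσ : σ x = z := (hV z hzV).1 hzA
  have hxr : x ∈ ball x0 r := (hV z hzV).2
  have hS1 : 1 ≤ S n := le_trans (one_le_pow₀ (by have : (0:ℝ) ≤ n := by positivity
                                                  linarith)) (hS n)
  have hS0 : 0 < S n := by linarith
  have hxx : ‖x - x1‖ < 2 * r := by
    rw [mem_ball, dist_eq_norm] at hxr hx1r
    have : x - x1 = (x - x0) - (x1 - x0) := by abel
    rw [this]
    linarith [norm_sub_le (x - x0) (x1 - x0)]
  have hline : ∀ t : ℂ, ‖t‖ < 3 / 2 → x1 + t • (x - x1) ∈ ball x0 R := by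
    intro t ht
    rw [mem_ball, dist_eq_norm] at hx1r ⊢
    have e : x1 + t • (x - x1) - x0 = (x1 - x0) + t • (x - x1) := by abel
    rw [e]
    have := norm_add_le (x1 - x0) (t • (x - x1))
    rw [norm_smul] at this
    have h5 : ‖t‖ * ‖x - x1‖ ≤ 3 / 2 * (2 * r) := by gcongr
    have h6 : R = 4 * r := by rw [hr]; ring
    linarith
  have key := h3c (fun t => eval (σ (x1 + t • (x - x1))) (q n)) (S n ^ (1 - c)) (S n * B ^ m n)
    (by positivity) (by positivity) ?_ ?_ ?_
  · simp only [one_smul, add_sub_cancel, hσ] at key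
    refine key.trans ?_
    have e1 : (S n ^ (1 - c)) ^ θ = S n ^ ((1 - c) * θ) := (Real.rpow_mul hS0.le _ _).symm
    have e2 : (S n * B ^ m n) ^ (1 - θ) = S n ^ (1 - θ) * (B ^ m n) ^ (1 - θ) :=
      Real.mul_rpow hS0.le (by positivity)
    have e3 : (B ^ m n) ^ (1 - θ) ≤ B ^ m n := by
      conv_rhs => rw [← Real.rpow_one (B ^ m n)]
      exact Real.rpow_le_rpow_of_exponent_le (one_le_pow₀ hB1) (by linarith)
    have e4 : K ≤ K ^ m n := le_self_pow₀ hK (by have := hm n; omega)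
    have e5 : (K * B) ^ m n ≤ S n ^ (θ * c / 2) :=
      bw_num (S n) (n + 1) _ _ _ (by have : (0:ℝ) ≤ n := by positivity
                                     linarith) (by positivity) (hS n) (by positivity) hn1.le
    rw [e1, e2]
    calc K * (S n ^ ((1 - c) * θ) * (S n ^ (1 - θ) * (B ^ m n) ^ (1 - θ)))
        ≤ K ^ m n * (S n ^ ((1 - c) * θ) * (S n ^ (1 - θ) * B ^ m n)) := by gcongr
      _ = (S n ^ ((1 - c) * θ) * S n ^ (1 - θ)) * (K * B) ^ m n := by rw [mul_pow]; ring
      _ ≤ (S n ^ ((1 - c) * θ) * S n ^ (1 - θ)) * S n ^ (θ * c / 2) := by gcongr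
      _ = S n ^ (1 - θ * c / 2) := by
        rw [← Real.rpow_add hS0, ← Real.rpow_add hS0]; congr 1; ring
  · intro t ht
    have ht' : ‖t‖ < 3 / 2 := by simpa using ht
    have a1 : AnalyticAt ℂ (fun t : ℂ => x1 + t • (x - x1)) t := by fun_prop
    have a2 : AnalyticAt ℂ (fun t : ℂ => σ (x1 + t • (x - x1))) t :=
      AnalyticAt.comp' (hR _ (hline t ht')).1 a1
    have a3 : AnalyticAt ℂ (fun t : ℂ => eval (σ (x1 + t • (x - x1))) (q n)) t :=
      AnalyticAt.comp' (g := fun z => eval z (q n)) (bw_mv_analytic (q n) _) a2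
    exact a3.differentiableAt.differentiableWithinAt
  · intro t ht
    have ht' : ‖t‖ < 3 / 2 := by linarith
    refine hη _ ?_ (hR _ (hline t ht')).2.1.1 n hn0
    rw [mem_ball, dist_eq_norm, add_sub_cancel_left, norm_smul]
    calc ‖t‖ * ‖x - x1‖ ≤ ρ * (2 * r) := by gcongr
      _ < η := hρη
  · intro t ht
    have hh := (hR _ (hline t ht)).2
    refine (hq n _ hh.1.1).trans ?_
    gcongr
    linarith [hh.2]

theorem bw_walsh {N : ℕ} {A : Set (Fin N → ℂ)} (hA : IsClosed A) (d : BWData A)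
    (hpr : ∀ p q : MvPolynomial (Fin N) ℂ, (∀ z ∈ A, eval z p * eval z q = 0) →
      (∀ z ∈ A, eval z p = 0) ∨ (∀ z ∈ A, eval z q = 0))
    (a : Fin N → ℂ) (ha : a ∈ A) (U : Set (Fin N → ℂ)) (hU : U ∈ 𝓝 a) :
    ∃ C : ℝ, 1 ≤ C ∧ ∀ m : ℕ, 1 ≤ m → ∀ q : MvPolynomial (Fin N) ℂ, q.totalDegree ≤ m →
      (∀ z ∈ A, z ∈ U → ‖eval z q‖ ≤ 1) → ∀ z ∈ A, ‖eval z q‖ ≤ (C * (1 + ‖z‖)) ^ m := by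
  by_contra hcon
  push Not at hcon
  have hn1 : ∀ n : ℕ, (1 : ℝ) ≤ (n : ℝ) + 1 := fun n => by
    have : (0:ℝ) ≤ n := by positivity
    linarith
  choose m hm q hdeg hqU z hzA hz using fun n : ℕ => hcon ((n : ℝ) + 1) (hn1 n)
  let W : ℕ → Set ℝ := fun n => (fun z => ‖eval z (q n)‖ / (1 + ‖z‖) ^ m n) '' A
  have hWb : ∀ n, BddAbove (W n) := by
    intro n
    obtain ⟨C, hC0, hC⟩ := bw_growth (q n) (m n) (hdeg n)
    refine ⟨C, ?_⟩
    rintro _ ⟨z, -, rfl⟩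
    rw [div_le_iff₀ (by positivity)]
    exact hC z
  set S : ℕ → ℝ := fun n => sSup (W n) with hSdef
  have hq : ∀ n, ∀ z ∈ A, ‖eval z (q n)‖ ≤ S n * (1 + ‖z‖) ^ m n := by
    intro n z hz
    rw [← div_le_iff₀ (by positivity)]
    exact le_csSup (hWb n) ⟨z, hz, rfl⟩
  have hSup : ∀ n B, (∀ z ∈ A, ‖eval z (q n)‖ ≤ B * (1 + ‖z‖) ^ m n) → S n ≤ B := by
    intro n B hB
    refine csSup_le ⟨_, a, ha, rfl⟩ ?_
    rintro _ ⟨z, hz, rfl⟩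
    rw [div_le_iff₀ (by positivity)]
    exact hB z hz
  have hS : ∀ n : ℕ, ((n : ℝ) + 1) ^ m n ≤ S n := by
    intro n
    have h1 := (hz n).le.trans (hq n _ (hzA n))
    rw [mul_pow] at h1
    exact le_of_mul_le_mul_right h1 (by positivity)
  have hS1 : ∀ n, 1 ≤ S n := fun n => (one_le_pow₀ (hn1 n)).trans (hS n)
  obtain ⟨z1, hz1A, hz1U, hz1D⟩ := bw_dense hA d a ha (interior U) (interior_mem_nhds.2 hU)
  have hz1Ω : z1 ∈ bwOm A q S := by
    refine ⟨1, one_pos, 0, ?_⟩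
    filter_upwards [isOpen_interior.mem_nhds hz1U] with w hw hwA n _
    rw [sub_self, Real.rpow_zero]
    exact hqU n w hwA (interior_subset hw)
  have hall : ∀ z ∈ A, eval (bwPi d.P z) d.D ≠ 0 → z ∈ bwOm A q S := by
    refine bw_connected d hpr _ ?_ z1 hz1A hz1D hz1Ω
    intro w hwA hwD
    obtain ⟨V, hV, hVV⟩ := bwOm_local d q S m hm hS hq w hwA hwD
    filter_upwards [hV] with w' hw' hw'A
    exact ⟨fun h => hVV w' hw' w (mem_of_mem_nhds hV) hw'A h,
      fun h => hVV w (mem_of_mem_nhds hV) w' hw' hwA h⟩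
  have hDe : ∀ᶠ x in 𝓝 (bwPi d.P z1), eval x d.D ≠ 0 :=
    (bw_mv_continuous d.D).continuousAt.eventually_ne hz1D
  obtain ⟨R, hR0, hR⟩ := Metric.eventually_nhds_iff_ball.1 hDe
  have hcomp := bw_compact hA d (bwPi d.P z1) (R / 2)
  have hunif : ∃ c : ℝ, 0 < c ∧ ∃ n0 : ℕ, ∀ w ∈ {z | z ∈ A ∧ ‖bwPi d.P z - bwPi d.P z1‖ ≤ R / 2},
      w ∈ A → ∀ n ≥ n0, ‖eval w (q n)‖ ≤ S n ^ (1 - c) := by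
    refine hcomp.induction_on (p := fun s => ∃ c : ℝ, 0 < c ∧ ∃ n0 : ℕ, ∀ w ∈ s,
      w ∈ A → ∀ n ≥ n0, ‖eval w (q n)‖ ≤ S n ^ (1 - c)) ?_ ?_ ?_ ?_
    · exact ⟨1, one_pos, 0, fun w hw => absurd hw (by simp)⟩
    · rintro s t hst ⟨c, hc, n0, h⟩
      exact ⟨c, hc, n0, fun w hw => h w (hst hw)⟩
    · rintro s t ⟨c, hc, n0, h⟩ ⟨c', hc', n0', h'⟩
      refine ⟨min c c', lt_min hc hc', max n0 n0', ?_⟩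
      rintro w (hw | hw) hwA n hn
      · refine (h w hw hwA n ((le_max_left _ _).trans hn)).trans ?_
        exact Real.rpow_le_rpow_of_exponent_le (hS1 n) (by linarith [min_le_left c c'])
      · refine (h' w hw hwA n ((le_max_right _ _).trans hn)).trans ?_
        exact Real.rpow_le_rpow_of_exponent_le (hS1 n) (by linarith [min_le_right c c'])
    · rintro w ⟨hwA, hw⟩
      obtain ⟨c, hc, n0, h⟩ := hall w hwA (hR _ (by rw [mem_ball, dist_eq_norm]; linarith))
      exact ⟨_, mem_nhdsWithin_of_mem_nhds h, c, hc, n0, fun w hw => hw⟩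
  obtain ⟨c, hc, n0, hcn⟩ := hunif
  obtain ⟨C, hC1, hC⟩ := bw_fibre d (bwPi d.P z1) (R / 2) (by positivity)
  obtain ⟨n1, hn1'⟩ := bw_large c C hc
  set n := max n0 n1 with hn
  have hS0 : 0 < S n := by linarith [hS1 n]
  have h1 := hC (m n) (hm n) (q n) (hdeg n) (S n ^ (1 - c)) (by positivity)
    (fun w hwA hw => hcn w ⟨hwA, hw⟩ hwA n (le_max_left _ _))
  have h2 : S n ≤ S n ^ (1 - c) * C ^ m n := hSup n _ fun w hw => by
    refine (h1 w hw).trans_eq ?_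
    rw [mul_pow]; ring
  have h3 := hn1' n (le_max_right _ _)
  have h4 : (((n : ℝ) + 1) ^ c) ^ m n ≤ S n ^ c :=
    bw_num (S n) (n + 1) c _ (m n) (hn1 n) hc (hS n) (by positivity) le_rfl
  have h5 : C ^ m n < (((n : ℝ) + 1) ^ c) ^ m n :=
    pow_lt_pow_left₀ h3 (by linarith) (by have := hm n; omega)
  have h6 : S n ^ (1 - c) * C ^ m n < S n ^ (1 - c) * S n ^ c :=
    mul_lt_mul_of_pos_left (h5.trans_le h4) (by positivity)
  rw [← Real.rpow_add hS0, sub_add_cancel, Real.rpow_one] at h6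
  linarith

theorem bw_greenV_le {N : ℕ} (E : Set (EuclideanSpace ℂ (Fin N))) (z : EuclideanSpace ℂ (Fin N))
    (B : ℝ) (hB : 1 ≤ B)
    (h : ∀ q : MvPolynomial (Fin N) ℂ, 1 ≤ q.totalDegree → (∀ w ∈ E, ‖evalAt w q‖ ≤ 1) →
      ‖evalAt z q‖ ≤ B ^ q.totalDegree) : greenV E z ≤ ((Real.log B : ℝ) : EReal) := by
  refine sSup_le ?_
  rintro _ ⟨q, hq1, hq, rfl⟩
  rw [EReal.coe_le_coe_iff]
  have hm : (0 : ℝ) < q.totalDegree := by exact_mod_cast hq1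
  rw [inv_mul_le_iff₀ hm]
  refine max_le ?_ (mul_nonneg hm.le (Real.log_nonneg hB))
  rcases (norm_nonneg (evalAt z q)).eq_or_lt with h0 | h0
  · rw [← h0, Real.log_zero]; exact mul_nonneg hm.le (Real.log_nonneg hB)
  · rw [← Real.log_pow]
    exact Real.log_le_log h0 (h q hq1 hq)

theorem bw_le_greenV {M : ℕ} (K : Set (EuclideanSpace ℂ (Fin M))) (b w : EuclideanSpace ℂ (Fin M))
    (δ : ℝ) (hδ : 0 < δ) (hK : ∀ w ∈ K, dist w b ≤ δ) (j : Fin M) :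
    ((Real.log (‖w j - b j‖ / δ) : ℝ) : EReal) ≤ greenV K w := by
  set q : MvPolynomial (Fin M) ℂ := C ((δ : ℂ)⁻¹) * (X j - C (b j)) with hq
  have hev : ∀ v : EuclideanSpace ℂ (Fin M), ‖evalAt v q‖ = ‖v j - b j‖ / δ := by
    intro v
    rw [evalAt, hq]
    simp [abs_of_pos hδ, div_eq_inv_mul]
  have hδ' : (δ : ℂ)⁻¹ ≠ 0 := by simpa using hδ.ne'
  have hdeg : q.totalDegree = 1 := by
    apply le_antisymm
    · refine (totalDegree_mul _ _).trans ?_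
      rw [totalDegree_C, zero_add]
      exact (totalDegree_sub_C_le _ _).trans (by simp)
    · by_contra hlt
      have h0 : q.totalDegree = 0 := by omega
      obtain hc := totalDegree_eq_zero_iff_eq_C.1 h0
      have h1 := congrArg (eval fun i => b i) hc
      have h2 := congrArg (eval fun i => b i + 1) hc
      simp only [eval_C] at h1 h2
      rw [← h1, hq] at h2
      simp [hδ.ne'] at h2
  refine le_trans ?_ (le_sSup ⟨q, hdeg.ge, ?_, rfl⟩)
  · rw [hdeg, hev, EReal.coe_le_coe_iff]
    simp
  · intro v hv
    rw [hev, div_le_one hδ]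
    have := hK v hv
    rw [dist_eq_norm] at this
    exact le_trans (by simpa using PiLp.norm_apply_le (v - b) j) this

theorem bw_walsh_alg {N : ℕ} (A : Set (EuclideanSpace ℂ (Fin N)))
    (halg : IsAlgebraicSet A) (hprime : (vanishIdeal A).IsPrime)
    (a : EuclideanSpace ℂ (Fin N)) (ha : a ∈ A) (U : Set (EuclideanSpace ℂ (Fin N)))
    (hU : U ∈ 𝓝 a) :
    ∃ C : ℝ, 1 ≤ C ∧ ∀ z ∈ A, greenV (A ∩ U) z ≤ ((Real.log (C * (1 + ‖z‖)) : ℝ) : EReal) := by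
  set A' : Set (Fin N → ℂ) := {x | WithLp.toLp 2 x ∈ A} with hA'
  have hI : ∀ p, p ∈ vanishIdeal A ↔ ∀ x ∈ A', eval x p = 0 := by
    intro p
    rw [vanishIdeal, RingHom.mem_ker]
    constructor
    · intro h x hx
      exact congrFun h ⟨WithLp.toLp 2 x, hx⟩
    · intro h
      funext ⟨z, hz⟩
      exact h (fun i => z i) hz
  obtain ⟨Sf, hSf⟩ := halg
  have hmemA : ∀ x, x ∈ A' ↔ ∀ p ∈ Sf, eval x p = 0 := by
    intro x
    rw [hA', hSf]
    rfl
  have hAI : ∀ x, (∀ p ∈ vanishIdeal A, eval x p = 0) → x ∈ A' := by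
    intro x hx
    rw [hmemA]
    intro p hp
    exact hx p ((hI p).2 fun y hy => (hmemA y).1 hy p hp)
  have hclosed : IsClosed A' := by
    have : A' = ⋂ p ∈ Sf, {x | eval x p = 0} := by
      ext x; rw [hmemA]; simp
    rw [this]
    exact isClosed_biInter fun p _ => isClosed_eq (bw_mv_continuous p) continuous_const
  have ha' : (fun i => a i) ∈ A' := ha
  obtain ⟨d⟩ := bwData_exists A' ⟨_, ha'⟩ (vanishIdeal A) hI hprime hAI
  have hpr : ∀ p q : MvPolynomial (Fin N) ℂ, (∀ z ∈ A', eval z p * eval z q = 0) →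
      (∀ z ∈ A', eval z p = 0) ∨ (∀ z ∈ A', eval z q = 0) := by
    intro p q h
    rw [← hI, ← hI]
    refine hprime.mem_or_mem ((hI _).2 ?_)
    intro z hz
    rw [map_mul]; exact h z hz
  have hcont : Continuous (fun x : Fin N → ℂ => (WithLp.toLp 2 x : EuclideanSpace ℂ (Fin N))) :=
    PiLp.continuous_toLp 2 _
  obtain ⟨C, hC1, hC⟩ := bw_walsh hclosed d hpr (fun i => a i) ha'
    ((fun x : Fin N → ℂ => (WithLp.toLp 2 x : EuclideanSpace ℂ (Fin N))) ⁻¹' U)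
    (hcont.continuousAt.preimage_mem_nhds hU)
  refine ⟨C, hC1, fun z hz => bw_greenV_le _ _ _ ?_ ?_⟩
  · have := norm_nonneg z
    nlinarith
  · intro q hq1 hq
    have h1 := hC q.totalDegree hq1 q le_rfl (fun x hx hxU => hq _ ⟨hx, hxU⟩) (fun i => z i) hz
    refine h1.trans ?_
    gcongr
    rw [pi_norm_le_iff_of_nonneg (norm_nonneg z)]
    exact fun i => PiLp.norm_apply_le z i

theorem bw_growthExp {N M : ℕ} (A : Set (EuclideanSpace ℂ (Fin N)))
    (f : EuclideanSpace ℂ (Fin N) → EuclideanSpace ℂ (Fin M)) (G d : ℝ) (hG : 0 < G)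
    (h : ∀ z ∈ A, 1 ≤ ‖z‖ → ‖f z‖ ≤ G * ‖z‖ ^ d) : growthExp f A ≤ (d : EReal) := by
  rw [← EReal.le_of_forall_lt_iff_le]
  intro d' hd'
  have hd' : d < d' := by exact_mod_cast hd'
  refine Filter.limsup_le_of_le (by isBoundedDefault) ?_
  have hlog : ∀ᶠ z in atInftyOn A, Real.log G ≤ (d' - d) * Real.log ‖z‖ := by
    refine Filter.Eventually.filter_mono inf_le_left ?_
    have : Tendsto (fun z : EuclideanSpace ℂ (Fin N) => (d' - d) * Real.log ‖z‖)
        (comap (fun z => ‖z‖) atTop) atTop :=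
      (Real.tendsto_log_atTop.const_mul_atTop (sub_pos.2 hd')).comp tendsto_comap
    exact this.eventually_ge_atTop _
  have hbig : ∀ᶠ z in atInftyOn A, 1 < ‖z‖ :=
    Filter.Eventually.filter_mono inf_le_left (tendsto_comap.eventually_gt_atTop 1)
  have hmem : ∀ᶠ z in atInftyOn A, z ∈ A :=
    Filter.Eventually.filter_mono inf_le_right (mem_principal_self A)
  filter_upwards [hlog, hbig, hmem] with z h1 h2 h3
  have hl : 0 < Real.log ‖z‖ := Real.log_pos h2
  have hz0 : ‖z‖ ≠ 0 := by linarith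
  have hz1 : 0 < ‖z‖ := by linarith
  rw [logRatio, elog, elog, if_neg hz0]
  by_cases hf : ‖f z‖ = 0
  · rw [if_pos hf, EReal.bot_div_of_pos_ne_top (by exact_mod_cast hl) (EReal.coe_ne_top _)]
    exact bot_le
  · rw [if_neg hf, ← EReal.coe_div, EReal.coe_le_coe_iff, div_le_iff₀ hl]
    have h4 := Real.log_le_log (lt_of_le_of_ne (norm_nonneg _) (Ne.symm hf)) (h z h3 h2.le)
    rw [Real.log_mul hG.ne' (by positivity), Real.log_rpow hz1] at h4
    linarith

/-- Let `𝒜 ⊆ ℂᴺ` be an irreducible algebraic set of positive dimension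
(equiv., infinite) and `f : 𝒜 → ℂᴹ` a proper holomorphic mapping on `𝒜`. Let `b ∈ f(𝒜)`,
`δ > 0` and `K := f(𝒜) ∩ B̄(b,δ)`. If `V_K ∘ f ≤ d · V_{f⁻¹(K)}` on `𝒜` for some `d > 0`,
then `ρ(f,𝒜) = limsup_{𝒜 ∋ z → ∞} log ‖f z‖ / log ‖z‖ ≤ d`. -/
theorem statement15 {N M : ℕ} (A : Set (EuclideanSpace ℂ (Fin N)))
    (f : EuclideanSpace ℂ (Fin N) → EuclideanSpace ℂ (Fin M))
    (halg : IsAlgebraicSet A) (hprime : (vanishIdeal A).IsPrime) (hinf : A.Infinite)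
    (hholo : IsHoloOn f A)
    (hproper : ∀ K : Set (EuclideanSpace ℂ (Fin M)), IsCompact K → IsCompact (A ∩ f ⁻¹' K))
    (b : EuclideanSpace ℂ (Fin M)) (hb : b ∈ f '' A) (δ : ℝ) (hδ : 0 < δ)
    (d : ℝ) (hd : 0 < d)
    (hineq : ∀ z ∈ A,
      greenV (f '' A ∩ Metric.closedBall b δ) (f z) ≤
        (d : EReal) * greenV (A ∩ f ⁻¹' (f '' A ∩ Metric.closedBall b δ)) z) :
    growthExp f A ≤ (d : EReal) := by
  obtain ⟨a, ha, hab⟩ := hb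
  obtain ⟨U0, hU0, haU0, F, hF, hfF⟩ := hholo a ha
  have hFc : ContinuousAt F a := (hF.differentiableAt (hU0.mem_nhds haU0)).continuousAt
  have hFa : F a = b := by rw [← hfF ⟨haU0, ha⟩, hab]
  have hU : U0 ∩ F ⁻¹' closedBall b δ ∈ 𝓝 a := by
    refine inter_mem (hU0.mem_nhds haU0) (hFc.preimage_mem_nhds ?_)
    rw [hFa]; exact closedBall_mem_nhds b hδ
  obtain ⟨C, hC1, hC⟩ := bw_walsh_alg A halg hprime a ha _ hU
  have hsub : A ∩ (U0 ∩ F ⁻¹' closedBall b δ) ⊆ A ∩ f ⁻¹' (f '' A ∩ closedBall b δ) := by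
    rintro z ⟨hzA, hzU, hzF⟩
    refine ⟨hzA, ⟨z, hzA, rfl⟩, ?_⟩
    rw [hfF ⟨hzU, hzA⟩]; exact hzF
  have hmono : ∀ z, greenV (A ∩ f ⁻¹' (f '' A ∩ closedBall b δ)) z ≤
      greenV (A ∩ (U0 ∩ F ⁻¹' closedBall b δ)) z := by
    intro z
    refine sSup_le_sSup ?_
    rintro _ ⟨q, h1, h2, rfl⟩
    exact ⟨q, h1, fun w hw => h2 w (hsub hw), rfl⟩
  have hcoord : ∀ z ∈ A, ∀ j, ‖f z j - b j‖ ≤ δ * (C * (1 + ‖z‖)) ^ d := by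
    intro z hz j
    have hpos : 0 < C * (1 + ‖z‖) := by positivity
    have h1 := bw_le_greenV (f '' A ∩ closedBall b δ) b (f z) δ hδ (fun w hw => hw.2) j
    have h2 : (d : EReal) * greenV (A ∩ f ⁻¹' (f '' A ∩ closedBall b δ)) z ≤
        (d : EReal) * ((Real.log (C * (1 + ‖z‖)) : ℝ) : EReal) :=
      mul_le_mul_of_nonneg_left ((hmono z).trans (hC z hz)) (by exact_mod_cast hd.le)
    have h3 := (h1.trans (hineq z hz)).trans h2
    rw [← EReal.coe_mul, EReal.coe_le_coe_iff, ← Real.log_rpow hpos] at h3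
    rcases (norm_nonneg (f z j - b j)).eq_or_lt with h0 | h0
    · rw [← h0]; positivity
    · rw [Real.log_le_log_iff (by positivity) (by positivity), div_le_iff₀ hδ] at h3
      linarith
  refine bw_growthExp A f (M * (‖b‖ + δ) * (2 * C) ^ d + 1) d (by positivity) ?_
  intro z hz hz1
  have hone : 1 ≤ (C * (1 + ‖z‖)) ^ d :=
    Real.one_le_rpow (by nlinarith) hd.le
  have h1 : ∀ j, ‖f z j‖ ≤ (‖b‖ + δ) * (C * (1 + ‖z‖)) ^ d := by
    intro j
    have e1 := hcoord z hz j
    have e2 : ‖b j‖ ≤ ‖b‖ := PiLp.norm_apply_le b j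
    have e3 : ‖f z j‖ ≤ ‖f z j - b j‖ + ‖b j‖ := by
      simpa using norm_add_le (f z j - b j) (b j)
    have e4 : ‖b‖ ≤ ‖b‖ * (C * (1 + ‖z‖)) ^ d := le_mul_of_one_le_right (norm_nonneg _) hone
    rw [add_mul]; linarith
  have h2 : ‖f z‖ ≤ ∑ j, ‖f z j‖ := by
    rw [EuclideanSpace.norm_eq]
    refine Real.sqrt_le_iff.2 ⟨by positivity, ?_⟩
    exact Finset.sum_sq_le_sq_sum_of_nonneg fun _ _ => norm_nonneg _
  have h3 : (C * (1 + ‖z‖)) ^ d ≤ (2 * C) ^ d * ‖z‖ ^ d := by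
    rw [← Real.mul_rpow (by positivity) (by positivity)]
    exact Real.rpow_le_rpow (by positivity) (by nlinarith) hd.le
  calc ‖f z‖ ≤ ∑ j : Fin M, (‖b‖ + δ) * (C * (1 + ‖z‖)) ^ d :=
        h2.trans (Finset.sum_le_sum fun j _ => h1 j)
    _ = M * (‖b‖ + δ) * (C * (1 + ‖z‖)) ^ d := by simp; ring
    _ ≤ M * (‖b‖ + δ) * ((2 * C) ^ d * ‖z‖ ^ d) := by gcongr
    _ ≤ (M * (‖b‖ + δ) * (2 * C) ^ d + 1) * ‖z‖ ^ d := by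
      have : 0 ≤ ‖z‖ ^ d := by positivity
      linarith
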